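/- arXiv:2204.06317 — 12 statements merged into one kernel-verified Lean document; each statement's English description precedes it below -/
import Mathlib

section
/- For every real number Δ with 0 < Δ < π/2, the number a = arccos((cos Δ + √(cos² Δ + 8))/4) satisfies 0 < a < π/2, cos(2a) = cos Δ · cos a, and 2 · sin γ · cos a = 1, where γ = arcsin((−cos Δ + √(cos² Δ + 8))/4). -/
open Real

theorem stmt_1 (Δ : ℝ) (h1 : 0 < Δ) (h2 : Δ < π / 2) :
    let γ := arcsin ((-cos Δ + sqrt (cos Δ ^ 2 + 8)) / 4)
    let a := arccos ((cos Δ + sqrt (cos Δ ^ 2 + 8)) / 4)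
    0 < a ∧ a < π / 2 ∧ cos (2 * a) = cos Δ * cos a ∧ 2 * sin γ * cos a = 1 := by
  intro γ a
  have hc0 : 0 < cos Δ := cos_pos_of_mem_Ioo ⟨by linarith, h2⟩
  have hc1 : cos Δ < 1 := by
    simpa using cos_lt_cos_of_nonneg_of_le_pi_div_two le_rfl h2.le h1
  have hsq : sqrt (cos Δ ^ 2 + 8) ^ 2 = cos Δ ^ 2 + 8 := sq_sqrt (by positivity)
  have hlt : sqrt (cos Δ ^ 2 + 8) < 4 - cos Δ := by
    rw [sqrt_lt' (by linarith)]
    nlinarith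
  have hgt : cos Δ < sqrt (cos Δ ^ 2 + 8) := lt_sqrt_of_sq_lt (by linarith)
  have hcos : cos a = (cos Δ + sqrt (cos Δ ^ 2 + 8)) / 4 :=
    cos_arccos (by linarith) (by linarith)
  have hsin : sin γ = (-cos Δ + sqrt (cos Δ ^ 2 + 8)) / 4 :=
    sin_arcsin (by linarith) (by linarith)
  refine ⟨arccos_pos.2 (by linarith), arccos_lt_pi_div_two.2 (by linarith), ?_, ?_⟩
  · rw [cos_two_mul, hcos]
    linear_combination hsq / 8
  · rw [hsin, hcos]
    linear_combination hsq / 8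
end

section
/- Let Δ ∈ (0, π/2) and set γ = arcsin((−cos Δ + √(cos² Δ + 8))/4). Suppose α, β are real numbers with 0 < β ≤ α, α + β ≤ π/2, and cos(α + β) = cos Δ · sin β. Then β ≤ γ ≤ α. Moreover β = γ if and only if α = γ, and in that case α = β = γ. -/
open Real

/-- The angle `arcsin ((-c + √(c² + 8)) / 4)` is an acute solution of `cos (2 x) = c * sin x`. -/
theorem arcsin_mem_Ioo_and_cos_two_mul {c : ℝ} (hc0 : 0 < c) (hc1 : c < 1) :
    0 < arcsin ((-c + sqrt (c ^ 2 + 8)) / 4) ∧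
    arcsin ((-c + sqrt (c ^ 2 + 8)) / 4) < π / 2 ∧
    cos (2 * arcsin ((-c + sqrt (c ^ 2 + 8)) / 4)) =
      c * sin (arcsin ((-c + sqrt (c ^ 2 + 8)) / 4)) := by
  have hsq : sqrt (c ^ 2 + 8) ^ 2 = c ^ 2 + 8 := sq_sqrt (by positivity)
  have hlower : c < sqrt (c ^ 2 + 8) := lt_sqrt_of_sq_lt (by linarith)
  have hupper : sqrt (c ^ 2 + 8) < c + 4 := (sqrt_lt' (by linarith)).2 (by nlinarith)
  refine ⟨arcsin_pos.2 (by linarith), arcsin_lt_pi_div_two.2 (by linarith), ?_⟩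
  rw [cos_two_mul, cos_sq', sin_arcsin (by linarith) (by linarith)]
  linear_combination (-1 / 8) * hsq

/-- If `x` and `y` are at most `x'` and `y'`, with one inequality strict, then
`cos (x + y) = c * sin y` cannot hold at both `(x, y)` and `(x', y')`. -/
theorem not_cos_add_eq_mul_sin_of_lt {c x y x' y' : ℝ} (hc : 0 ≤ c) (hx : 0 ≤ x) (hy : 0 ≤ y)
    (hyy : y ≤ y') (hlt : x + y < x' + y') (hy' : y' ≤ π / 2) (hsum : x' + y' ≤ π)
    (h : cos (x + y) = c * sin y) : cos (x' + y') ≠ c * sin y' := by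
  have hcos : cos (x' + y') < cos (x + y) :=
    cos_lt_cos_of_nonneg_of_le_pi (by linarith) hsum hlt
  have hsin : sin y ≤ sin y' :=
    sin_le_sin_of_le_of_le_pi_div_two (by linarith [pi_pos]) hy' hyy
  have := mul_le_mul_of_nonneg_left hsin hc
  linarith

theorem stmt_2 (Δ : ℝ) (hΔ1 : 0 < Δ) (hΔ2 : Δ < π / 2)
    (γ : ℝ) (hγ : γ = arcsin ((-cos Δ + sqrt (cos Δ ^ 2 + 8)) / 4))
    (α β : ℝ) (hβ : 0 < β) (hβα : β ≤ α) (hsum : α + β ≤ π / 2)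
    (heq : cos (α + β) = cos Δ * sin β) :
    β ≤ γ ∧ γ ≤ α ∧ (β = γ ↔ α = γ) ∧ (β = γ → α = γ ∧ β = γ) := by
  have hc0 : 0 < cos Δ := cos_pos_of_mem_Ioo ⟨by linarith, hΔ2⟩
  have hc1 : cos Δ < 1 := by
    simpa using cos_lt_cos_of_nonneg_of_le_pi_div_two le_rfl hΔ2.le hΔ1
  obtain ⟨hγ0, hγ1, hγeq⟩ := arcsin_mem_Ioo_and_cos_two_mul hc0 hc1
  rw [← hγ] at hγ0 hγ1 hγeq
  rw [two_mul] at hγeq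
  have hle : β ≤ γ := by
    by_contra! h
    exact not_cos_add_eq_mul_sin_of_lt hc0.le hγ0.le hγ0.le h.le (by linarith)
      (by linarith) (by linarith) hγeq heq
  have hsum_ge : γ + γ ≤ α + β := by
    by_contra! h
    exact not_cos_add_eq_mul_sin_of_lt hc0.le (hβ.le.trans hβα) hβ.le hle h
      hγ1.le (by linarith) heq hγeq
  have hαγ : β = γ → α = γ := by
    rintro rfl
    by_contra h
    exact not_cos_add_eq_mul_sin_of_lt hc0.le hγ0.le hγ0.le le_rfl
      (add_lt_add_left (lt_of_le_of_ne hβα (Ne.symm h)) β) hγ1.le (by linarith) hγeq heq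
  exact ⟨hle, by linarith, ⟨hαγ, fun h => by linarith⟩, fun h => ⟨hαγ h, h⟩⟩
end

section
/- For every real number λ > 0, the function x ↦ f₁(x)/f₂(x) is strictly decreasing on the open interval (0, (−1 + √(1 + λ²))/λ), where f₁(x) = arccos((1 + λx)/√(1 + λ²)) and f₂(x) = arccos(x(1 + λx)/(λ − x)). -/
open Real

/-- The monotone form of l'Hôpital's rule at the right endpoint: if `f` and `g` vanish at `b`, `g` is
decreasing and `f' / g'` is strictly decreasing, then so is `f / g`. -/
theorem strictAntiOn_div_of_deriv_ratio {a b : ℝ} {f g g' r : ℝ → ℝ}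
    (hf : ContinuousOn f (Set.Ioc a b)) (hg : ContinuousOn g (Set.Ioc a b))
    (hfb : f b = 0) (hgb : g b = 0)
    (hf' : ∀ x ∈ Set.Ioo a b, HasDerivAt f (r x * g' x) x)
    (hg' : ∀ x ∈ Set.Ioo a b, HasDerivAt g (g' x) x)
    (hneg : ∀ x ∈ Set.Ioo a b, g' x < 0) (hr : StrictAntiOn r (Set.Ioo a b)) :
    StrictAntiOn (fun x => f x / g x) (Set.Ioo a b) := by
  have cauchy : ∀ u v, a < u → u < v → v ≤ b →
      ∃ z ∈ Set.Ioo u v, f u - f v = r z * (g u - g v) := by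
    intro u v hu huv hv
    have hIcc : Set.Icc u v ⊆ Set.Ioc a b := fun z hz => ⟨hu.trans_le hz.1, hz.2.trans hv⟩
    have hIoo : Set.Ioo u v ⊆ Set.Ioo a b := fun z hz => ⟨hu.trans hz.1, hz.2.trans_le hv⟩
    obtain ⟨z, hz, h⟩ := exists_ratio_hasDerivAt_eq_ratio_slope f (fun x => r x * g' x) huv
      (hf.mono hIcc) (fun x hx => hf' x (hIoo hx)) g g' (hg.mono hIcc)
      (fun x hx => hg' x (hIoo hx))
    refine ⟨z, hz, mul_right_cancel₀ (hneg z (hIoo hz)).ne ?_⟩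
    linear_combination h
  have hanti : StrictAntiOn g (Set.Ioc a b) := by
    refine strictAntiOn_of_deriv_neg (convex_Ioc a b) hg fun x hx => ?_
    rw [interior_Ioc] at hx
    rw [(hg' x hx).deriv]
    exact hneg x hx
  have hpos : ∀ x ∈ Set.Ioo a b, 0 < g x := fun x hx =>
    hgb ▸ hanti ⟨hx.1, hx.2.le⟩ ⟨hx.1.trans hx.2, le_rfl⟩ hx.2
  intro x hx y hy hxy
  obtain ⟨z, hz, hfz⟩ := cauchy x y hx.1 hxy hy.2.le
  obtain ⟨w, hw, hfw⟩ := cauchy y b hy.1 hy.2 le_rfl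
  have hrzw : r w < r z :=
    hr ⟨hx.1.trans hz.1, hz.2.trans hy.2⟩ ⟨hy.1.trans hw.1, hw.2⟩ (hz.2.trans hw.1)
  have hgxy : g y < g x := hanti ⟨hx.1, hx.2.le⟩ ⟨hy.1, hy.2.le⟩ hxy
  rw [hfb, hgb, sub_zero, sub_zero] at hfw
  have hmul : 0 < (r z - r w) * (g x - g y) := mul_pos (sub_pos.2 hrzw) (sub_pos.2 hgxy)
  change f y / g y < f x / g x
  rw [hfw, mul_div_cancel_right₀ _ (hpos y hy).ne', lt_div_iff₀ (hpos x hx)]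
  nlinarith

theorem hasDerivAt_arccos_line {lam x : ℝ} (hlam : 0 < lam)
    (hx : 0 < lam - 2 * x - lam * x ^ 2) :
    HasDerivAt (fun x : ℝ => arccos ((1 + lam * x) / sqrt (1 + lam ^ 2)))
      (-(lam / sqrt (lam * (lam - 2 * x - lam * x ^ 2)))) x := by
  have hW : 0 < lam * (lam - 2 * x - lam * x ^ 2) := mul_pos hlam hx
  have hS : 0 < 1 + lam ^ 2 := by positivity
  have hu : 1 - ((1 + lam * x) / sqrt (1 + lam ^ 2)) ^ 2 =
      lam * (lam - 2 * x - lam * x ^ 2) / (1 + lam ^ 2) := by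
    rw [div_pow, sq_sqrt hS.le]
    field_simp
    ring
  have hu0 : 0 < 1 - ((1 + lam * x) / sqrt (1 + lam ^ 2)) ^ 2 := hu ▸ div_pos hW hS
  have hd : HasDerivAt (fun x : ℝ => (1 + lam * x) / sqrt (1 + lam ^ 2))
      (lam / sqrt (1 + lam ^ 2)) x := by
    simpa using (((hasDerivAt_id x).const_mul lam).const_add 1).div_const (sqrt (1 + lam ^ 2))
  refine ((hasDerivAt_arccos (fun h => by rw [h] at hu0; norm_num at hu0)
    (fun h => by rw [h] at hu0; norm_num at hu0)).comp x hd).congr_deriv ?_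
  rw [hu, sqrt_div hW.le]
  have := sqrt_pos.2 hW
  have := sqrt_pos.2 hS
  field_simp

theorem hasDerivAt_arccos_quotient {lam x : ℝ} (hlam : 0 < lam) (hxlam : x < lam)
    (hx : 0 < lam - 2 * x - lam * x ^ 2) :
    HasDerivAt (fun x : ℝ => arccos (x * (1 + lam * x) / (lam - x)))
      (-(lam * (1 + 2 * lam * x - x ^ 2) / ((lam - x) *
        (sqrt (lam * (lam - 2 * x - lam * x ^ 2)) * sqrt (1 + x ^ 2))))) x := by
  have hW : 0 < lam * (lam - 2 * x - lam * x ^ 2) := mul_pos hlam hx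
  have hS : 0 < 1 + x ^ 2 := by positivity
  have hq : 0 < lam - x := sub_pos.2 hxlam
  have hu : 1 - (x * (1 + lam * x) / (lam - x)) ^ 2 =
      lam * (lam - 2 * x - lam * x ^ 2) * (1 + x ^ 2) / (lam - x) ^ 2 := by
    field_simp
    ring
  have hu0 : 0 < 1 - (x * (1 + lam * x) / (lam - x)) ^ 2 := by
    rw [hu]
    positivity
  have hd : HasDerivAt (fun x : ℝ => x * (1 + lam * x) / (lam - x))
      (lam * (1 + 2 * lam * x - x ^ 2) / (lam - x) ^ 2) x := by
    refine (((hasDerivAt_id' x).mul (((hasDerivAt_id' x).const_mul lam).const_add 1)).div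
      ((hasDerivAt_id' x).const_sub lam) hq.ne').congr_deriv ?_
    simp only [Pi.mul_apply]
    ring
  refine ((hasDerivAt_arccos (fun h => by rw [h] at hu0; norm_num at hu0)
    (fun h => by rw [h] at hu0; norm_num at hu0)).comp x hd).congr_deriv ?_
  rw [hu, sqrt_div (by positivity), sqrt_mul hW.le, sqrt_sq hq.le]
  have := sqrt_pos.2 hW
  have := sqrt_pos.2 hS
  field_simp

theorem deriv_ratio_lt {lam x y : ℝ} (hx : 0 < x) (hxy : x < y) (hy : y < lam)
    (hWy : 0 < lam - 2 * y - lam * y ^ 2) :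
    (lam - y) * sqrt (1 + y ^ 2) / (1 + 2 * lam * y - y ^ 2) <
      (lam - x) * sqrt (1 + x ^ 2) / (1 + 2 * lam * x - x ^ 2) := by
  have hy0 : 0 < y := hx.trans hxy
  have hlam : 0 < lam := hy0.trans hy
  have hDx : 0 < 1 + 2 * lam * x - x ^ 2 := by nlinarith
  have hDy : 0 < 1 + 2 * lam * y - y ^ 2 := by nlinarith
  have hs : 0 < sqrt (1 + x ^ 2) := sqrt_pos.2 (by positivity)
  have hst : sqrt (1 + x ^ 2) < sqrt (1 + y ^ 2) := sqrt_lt_sqrt (by positivity) (by gcongr)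
  have hs2 : sqrt (1 + x ^ 2) ^ 2 = 1 + x ^ 2 := sq_sqrt (by positivity)
  have ht2 : sqrt (1 + y ^ 2) ^ 2 = 1 + y ^ 2 := sq_sqrt (by positivity)
  set s := sqrt (1 + x ^ 2)
  set t := sqrt (1 + y ^ 2)
  have ht : 0 < t := hs.trans hst
  have hcross : t ^ 2 * (1 + 2 * lam * x - x ^ 2) < s ^ 2 * (1 + 2 * lam * y - y ^ 2) := by
    have hxyW : 0 < lam - (x + y) - lam * (x * y) := by
      have : x * y < y ^ 2 := by nlinarith
      nlinarith
    rw [hs2, ht2]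
    linear_combination 2 * (mul_pos (sub_pos.2 hxy) hxyW)
  have hlin : t * (1 + 2 * lam * x - x ^ 2) < s * (1 + 2 * lam * y - y ^ 2) := by
    refine lt_of_mul_lt_mul_left ?_ ht.le
    calc t * (t * (1 + 2 * lam * x - x ^ 2)) < s * (s * (1 + 2 * lam * y - y ^ 2)) := by
          linear_combination hcross
      _ ≤ t * (s * (1 + 2 * lam * y - y ^ 2)) := by gcongr
  rw [div_lt_div_iff₀ hDy hDx, mul_assoc (lam - y), mul_assoc (lam - x)]
  exact mul_lt_mul'' (by linarith) hlin (by linarith) (by positivity)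

theorem stmt_3 (lam : ℝ) (hlam : 0 < lam) :
    StrictAntiOn
      (fun x : ℝ => arccos ((1 + lam * x) / sqrt (1 + lam ^ 2)) /
        arccos (x * (1 + lam * x) / (lam - x)))
      (Set.Ioo 0 ((-1 + sqrt (1 + lam ^ 2)) / lam)) := by
  have hS : 1 < sqrt (1 + lam ^ 2) := by
    rw [lt_sqrt zero_le_one]
    nlinarith
  have hS2 : sqrt (1 + lam ^ 2) ^ 2 = 1 + lam ^ 2 := sq_sqrt (by positivity)
  set c := (-1 + sqrt (1 + lam ^ 2)) / lam with hc
  have hc0 : 0 < c := div_pos (by linarith) hlam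
  have hcS : 1 + lam * c = sqrt (1 + lam ^ 2) := by
    rw [hc]
    field_simp
    ring
  have hroot : lam - 2 * c - lam * c ^ 2 = 0 := by
    refine mul_left_cancel₀ hlam.ne' ?_
    rw [← hcS] at hS2
    linear_combination -hS2
  have hclam : c < lam := by nlinarith [mul_pos hlam (pow_pos hc0 2)]
  have hW : ∀ x ∈ Set.Ioo 0 c, 0 < lam - 2 * x - lam * x ^ 2 := by
    intro x hx
    have : x ^ 2 < c ^ 2 := pow_lt_pow_left₀ hx.2 hx.1.le two_ne_zero
    nlinarith [hx.2]
  have hD : ∀ x ∈ Set.Ioo 0 c, 0 < 1 + 2 * lam * x - x ^ 2 := fun x hx => by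
    nlinarith [hx.1, hx.2]
  refine strictAntiOn_div_of_deriv_ratio
    (g' := fun x => -(lam * (1 + 2 * lam * x - x ^ 2) / ((lam - x) *
        (sqrt (lam * (lam - 2 * x - lam * x ^ 2)) * sqrt (1 + x ^ 2)))))
    (r := fun x => (lam - x) * sqrt (1 + x ^ 2) / (1 + 2 * lam * x - x ^ 2))
    ?_ ?_ ?_ ?_ ?_ ?_ ?_ ?_
  · exact (continuous_arccos.comp (by fun_prop)).continuousOn
  · refine continuous_arccos.comp_continuousOn (ContinuousOn.div (by fun_prop) (by fun_prop) ?_)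
    exact fun x hx => (sub_pos.2 (hx.2.trans_lt hclam)).ne'
  · rw [hcS, div_self (by linarith), arccos_one]
  · rw [show c * (1 + lam * c) = lam - c by linear_combination -hroot,
      div_self (sub_pos.2 hclam).ne', arccos_one]
  · intro x hx
    refine (hasDerivAt_arccos_line hlam (hW x hx)).congr_deriv ?_
    have hDx := hD x hx
    have : 0 < lam - x := sub_pos.2 (hx.2.trans hclam)
    have := sqrt_pos.2 (mul_pos hlam (hW x hx))
    have : 0 < sqrt (1 + x ^ 2) := sqrt_pos.2 (by positivity)
    generalize 1 + 2 * lam * x - x ^ 2 = D at hDx ⊢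
    field_simp
  · exact fun x hx => hasDerivAt_arccos_quotient hlam (hx.2.trans hclam) (hW x hx)
  · intro x hx
    have := hD x hx
    have : 0 < lam - x := sub_pos.2 (hx.2.trans hclam)
    have := sqrt_pos.2 (mul_pos hlam (hW x hx))
    rw [neg_lt_zero]
    positivity
  · exact fun x hx y hy hxy => deriv_ratio_lt hx.1 hxy (hy.2.trans hclam) (hW y hy)
end

section
/- Fix λ > 0 and let x̄ = (−1 + √(1 + λ²))/λ. Define h(x) = (λ − x)·√(1 + x²)·f₂(x) + (x² − 2λx − 1)·f₁(x) for x ∈ (0, x̄]. Then h is strictly decreasing on (0, x̄], h(x̄) = 0, and consequently h(x) > 0 for every x ∈ (0, x̄). -/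
open Real

/-- Both arccosines have derivatives such that the terms not involving an arccosine cancel. -/
lemma hasDerivAt_arccos_combination {lam x : ℝ} (hlam : 0 < lam) (hx : 0 < x) (hxl : x < lam)
    (hQ : 0 < lam - 2 * x - lam * x ^ 2) :
    HasDerivAt (fun x : ℝ =>
      (lam - x) * sqrt (1 + x ^ 2) * arccos (x * (1 + lam * x) / (lam - x)) +
        (x ^ 2 - 2 * lam * x - 1) * arccos ((1 + lam * x) / sqrt (1 + lam ^ 2)))
      ((lam * x - 1 - 2 * x ^ 2) / sqrt (1 + x ^ 2) * arccos (x * (1 + lam * x) / (lam - x)) -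
        2 * (lam - x) * arccos ((1 + lam * x) / sqrt (1 + lam ^ 2))) x := by
  have hd : 0 < lam - x := by linarith
  have hS : 0 < sqrt (1 + lam ^ 2) := by positivity
  have hS2 : sqrt (1 + lam ^ 2) ^ 2 = 1 + lam ^ 2 := sq_sqrt (by positivity)
  have hR : 0 < sqrt (1 + x ^ 2) := by positivity
  have hR2 : sqrt (1 + x ^ 2) ^ 2 = 1 + x ^ 2 := sq_sqrt (by positivity)
  have hW : 0 < sqrt (lam * (lam - 2 * x - lam * x ^ 2)) := by positivity
  have hW2 : sqrt (lam * (lam - 2 * x - lam * x ^ 2)) ^ 2 = lam * (lam - 2 * x - lam * x ^ 2) :=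
    sq_sqrt (by positivity)
  set S := sqrt (1 + lam ^ 2)
  set W := sqrt (lam * (lam - 2 * x - lam * x ^ 2))
  have e1 : 1 - ((1 + lam * x) / S) ^ 2 = (W / S) ^ 2 := by
    rw [div_pow, div_pow, hW2, hS2]; field_simp; ring
  have e2 : 1 - (x * (1 + lam * x) / (lam - x)) ^ 2 = (W * sqrt (1 + x ^ 2) / (lam - x)) ^ 2 := by
    rw [div_pow, div_pow, mul_pow W, hW2, hR2]; field_simp; ring
  have p1 : 0 < (W / S) ^ 2 := by positivity
  have p2 : 0 < (W * sqrt (1 + x ^ 2) / (lam - x)) ^ 2 := by positivity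
  have s1 : sqrt (1 - ((1 + lam * x) / S) ^ 2) = W / S := by
    rw [e1, sqrt_sq (by positivity)]
  have s2 : sqrt (1 - (x * (1 + lam * x) / (lam - x)) ^ 2) =
      W * sqrt (1 + x ^ 2) / (lam - x) := by
    rw [e2, sqrt_sq (by positivity)]
  have hlin : HasDerivAt (fun x : ℝ => 1 + lam * x) lam x := by
    simpa using ((hasDerivAt_id x).const_mul lam).const_add 1
  have hsub : HasDerivAt (fun x : ℝ => lam - x) (-1) x := by
    simpa using (hasDerivAt_id x).const_sub lam
  have hf1 := (hasDerivAt_arccos (x := (1 + lam * x) / S)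
    (by intro h; rw [h] at e1; norm_num at e1; linarith)
    (by intro h; rw [h] at e1; norm_num at e1; linarith)).comp x (hlin.div_const S)
  have hu : HasDerivAt (fun x : ℝ => x * (1 + lam * x) / (lam - x))
      (lam * (1 + 2 * lam * x - x ^ 2) / (lam - x) ^ 2) x := by
    refine (((hasDerivAt_id' x).mul hlin).div hsub hd.ne').congr_deriv ?_
    simp only [Pi.mul_apply]
    ring
  have hf2 := (hasDerivAt_arccos (x := x * (1 + lam * x) / (lam - x))
    (by intro h; rw [h] at e2; norm_num at e2; linarith)
    (by intro h; rw [h] at e2; norm_num at e2; linarith)).comp x hu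
  have hr : HasDerivAt (fun x : ℝ => sqrt (1 + x ^ 2)) (x / sqrt (1 + x ^ 2)) x := by
    refine (((hasDerivAt_pow 2 x).const_add 1).sqrt (by positivity)).congr_deriv ?_
    norm_num
    field_simp
  have hp : HasDerivAt (fun x : ℝ => x ^ 2 - 2 * lam * x - 1) (2 * x - 2 * lam) x := by
    refine (((hasDerivAt_pow 2 x).sub
      ((hasDerivAt_id x).const_mul (2 * lam))).sub_const 1).congr_deriv ?_
    norm_num
  rw [s1] at hf1
  rw [s2] at hf2
  refine (((hsub.mul hr).mul hf2).add (hp.mul hf1)).congr_deriv ?_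
  simp only [Function.comp, Pi.mul_apply]
  set A := arccos (x * (1 + lam * x) / (lam - x))
  set B := arccos ((1 + lam * x) / S)
  set R := sqrt (1 + x ^ 2)
  have c : -1 * R + (lam - x) * (x / R) = (lam * x - 1 - 2 * x ^ 2) / R := by
    field_simp; rw [hR2]; ring
  rw [c]
  field_simp
  ring

/-- The derivative found in `hasDerivAt_arccos_combination` is negative. -/
lemma arccos_combination_deriv_neg {lam x : ℝ} (hlam : 0 < lam) (hx : 0 < x) (hxl : x < lam)
    (hx1 : x < 1) (hQ : 0 < lam - 2 * x - lam * x ^ 2) :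
    (lam * x - 1 - 2 * x ^ 2) / sqrt (1 + x ^ 2) * arccos (x * (1 + lam * x) / (lam - x)) -
        2 * (lam - x) * arccos ((1 + lam * x) / sqrt (1 + lam ^ 2)) < 0 := by
  have hd : 0 < lam - x := by linarith
  have hS : 0 < sqrt (1 + lam ^ 2) := by positivity
  have hS2 : sqrt (1 + lam ^ 2) ^ 2 = 1 + lam ^ 2 := sq_sqrt (by positivity)
  have hR : 0 < sqrt (1 + x ^ 2) := by positivity
  have hR2 : sqrt (1 + x ^ 2) ^ 2 = 1 + x ^ 2 := sq_sqrt (by positivity)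
  have hW : 0 < sqrt (lam * (lam - 2 * x - lam * x ^ 2)) := by positivity
  have hW2 : sqrt (lam * (lam - 2 * x - lam * x ^ 2)) ^ 2 = lam * (lam - 2 * x - lam * x ^ 2) :=
    sq_sqrt (by positivity)
  set S := sqrt (1 + lam ^ 2)
  set W := sqrt (lam * (lam - 2 * x - lam * x ^ 2))
  set R := sqrt (1 + x ^ 2)
  have s1 : sin (arccos ((1 + lam * x) / S)) = W / S := by
    have e : 1 - ((1 + lam * x) / S) ^ 2 = (W / S) ^ 2 := by
      rw [div_pow, div_pow, hW2, hS2]; field_simp; ring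
    rw [sin_arccos, e, sqrt_sq (by positivity)]
  have s2 : sin (arccos (x * (1 + lam * x) / (lam - x))) = W * R / (lam - x) := by
    have e : 1 - (x * (1 + lam * x) / (lam - x)) ^ 2 = (W * R / (lam - x)) ^ 2 := by
      rw [div_pow, div_pow, mul_pow W, hW2, hR2]; field_simp; ring
    rw [sin_arccos, e, sqrt_sq (by positivity)]
  have b1 : W / S ≤ arccos ((1 + lam * x) / S) := s1 ▸ sin_le (arccos_nonneg _)
  have b2 : arccos (x * (1 + lam * x) / (lam - x)) ≤ 2 * (W * R / (lam - x)) := by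
    have h := mul_le_sin (arccos_nonneg (x * (1 + lam * x) / (lam - x)))
      (arccos_le_pi_div_two.2 (by positivity))
    rw [s2, div_mul_eq_mul_div, div_le_iff₀ pi_pos] at h
    have : 0 < W * R / (lam - x) := by positivity
    nlinarith [pi_le_four]
  have n2 := arccos_nonneg (x * (1 + lam * x) / (lam - x))
  set A := arccos (x * (1 + lam * x) / (lam - x))
  set B := arccos ((1 + lam * x) / S)
  have hB : 0 < B := lt_of_lt_of_le (by positivity) b1
  rcases le_or_gt (lam * x - 1 - 2 * x ^ 2) 0 with hN | hN
  · have : (lam * x - 1 - 2 * x ^ 2) / R * A ≤ 0 :=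
      mul_nonpos_of_nonpos_of_nonneg (div_nonpos_of_nonpos_of_nonneg hN hR.le) n2
    have : 0 < 2 * (lam - x) * B := by positivity
    linarith
  · have hl2 : 2 ≤ lam := by nlinarith [sq_nonneg (x - 1)]
    have hSle : S ≤ lam + 1 / 4 := by
      apply sqrt_le_iff.2
      constructor <;> nlinarith
    have key : S * (lam * x - 1 - 2 * x ^ 2) < (lam - x) ^ 2 := by
      have h1 := mul_le_mul_of_nonneg_right hSle hN.le
      have h2 : 0 < lam ^ 2 * (1 - x) := mul_pos (by positivity) (by linarith)
      have h3 : 0 < lam * (2 * x ^ 2 - 9 / 4 * x + 1) :=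
        mul_pos hlam (by nlinarith [sq_nonneg (x - 9 / 16)])
      nlinarith [sq_nonneg x]
    have u1 : (lam * x - 1 - 2 * x ^ 2) / R * A ≤
        (lam * x - 1 - 2 * x ^ 2) / R * (2 * (W * R / (lam - x))) :=
      mul_le_mul_of_nonneg_left b2 (by positivity)
    have u2 : 2 * (lam - x) * (W / S) ≤ 2 * (lam - x) * B :=
      mul_le_mul_of_nonneg_left b1 (by positivity)
    have u3 : (lam * x - 1 - 2 * x ^ 2) / R * (2 * (W * R / (lam - x))) <
        2 * (lam - x) * (W / S) := by
      have e1 : (lam * x - 1 - 2 * x ^ 2) / R * (2 * (W * R / (lam - x))) =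
          2 * W * (S * (lam * x - 1 - 2 * x ^ 2)) / (S * (lam - x)) := by field_simp
      have e2 : 2 * (lam - x) * (W / S) = 2 * W * (lam - x) ^ 2 / (S * (lam - x)) := by
        field_simp
      rw [e1, e2]
      gcongr
    linarith

theorem stmt_4 (lam : ℝ) (hlam : 0 < lam) :
    let xbar := (-1 + sqrt (1 + lam ^ 2)) / lam
    let f₁ := fun x : ℝ => arccos ((1 + lam * x) / sqrt (1 + lam ^ 2))
    let f₂ := fun x : ℝ => arccos (x * (1 + lam * x) / (lam - x))
    let h := fun x : ℝ =>
      (lam - x) * sqrt (1 + x ^ 2) * f₂ x + (x ^ 2 - 2 * lam * x - 1) * f₁ x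
    StrictAntiOn h (Set.Ioc 0 xbar) ∧ h xbar = 0 ∧
      ∀ x ∈ Set.Ioo 0 xbar, 0 < h x := by
  intro xbar f₁ f₂ h
  have hS2 : sqrt (1 + lam ^ 2) ^ 2 = 1 + lam ^ 2 := sq_sqrt (by positivity)
  have hS1 : 1 < sqrt (1 + lam ^ 2) := by
    rw [lt_sqrt (by norm_num)]; nlinarith
  have hS0 : sqrt (1 + lam ^ 2) ≠ 0 := by positivity
  have hb : 1 + lam * xbar = sqrt (1 + lam ^ 2) := by
    simp only [xbar]; field_simp; ring
  have hb0 : 0 < xbar := div_pos (by linarith) hlam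
  have hroot : xbar * (1 + lam * xbar) = lam - xbar := by
    have : lam * (xbar * (1 + lam * xbar)) = lam * (lam - xbar) := by
      rw [← hb] at hS2; linarith
    exact mul_left_cancel₀ hlam.ne' this
  have hbl : xbar < lam := by
    have : 0 < xbar * (1 + lam * xbar) := by positivity
    linarith
  have hb1 : xbar < 1 := by
    by_contra! hc
    nlinarith [mul_le_mul_of_nonneg_left hc (mul_pos hlam hb0).le]
  have hanti : StrictAntiOn h (Set.Ioc 0 xbar) := by
    apply strictAntiOn_of_deriv_neg (convex_Ioc 0 xbar)
    · have hne : ∀ x ∈ Set.Ioc 0 xbar, lam - x ≠ 0 := fun x hx =>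
        (sub_pos.2 (hx.2.trans_lt hbl)).ne'
      have c2 : ContinuousOn f₂ (Set.Ioc 0 xbar) :=
        continuous_arccos.comp_continuousOn
          (ContinuousOn.div (by fun_prop) (by fun_prop) hne)
      have c1 : ContinuousOn f₁ (Set.Ioc 0 xbar) := by
        apply Continuous.continuousOn
        exact continuous_arccos.comp (by fun_prop)
      exact (ContinuousOn.mul (by fun_prop) c2).add (ContinuousOn.mul (by fun_prop) c1)
    · rw [interior_Ioc]
      intro x ⟨hx0, hxb⟩
      have hQ : 0 < lam - 2 * x - lam * x ^ 2 := by
        nlinarith [mul_pos hlam (mul_pos (sub_pos.2 hxb) (add_pos hx0 hb0))]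
      rw [(hasDerivAt_arccos_combination hlam hx0 (hxb.trans hbl) hQ).deriv]
      exact arccos_combination_deriv_neg hlam hx0 (hxb.trans hbl) (hxb.trans hb1) hQ
  have hzero : h xbar = 0 := by
    have h1 : f₁ xbar = 0 := by
      simp only [f₁]; rw [hb, div_self hS0, arccos_one]
    have h2 : f₂ xbar = 0 := by
      simp only [f₂]; rw [hroot, div_self (sub_pos.2 hbl).ne', arccos_one]
    simp only [h]; rw [h1, h2]; ring
  refine ⟨hanti, hzero, fun x hx => ?_⟩
  rw [← hzero]
  exact hanti ⟨hx.1, hx.2.le⟩ ⟨hb0, le_rfl⟩ hx.2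
end

section
/- Fix λ > 0 and let x̄ = (−1 + √(1 + λ²))/λ. Define t(x) = 2·f₁(x) − (3x/(2√(1 + x²)))·f₂(x) for x ∈ (0, x̄]. Then t is strictly decreasing on (0, x̄], t(x̄) = 0, and consequently 2·f₁(x) > (3x/(2√(1 + x²)))·f₂(x) for every x ∈ (0, x̄). -/
open Real

/-- The point `(-1 + √(1 + λ²)) / λ` is the positive root of `λ - 2x - λx²`. -/
lemma quadratic_pos_of_lt_root {lam x : ℝ} (hlam : 0 < lam) (hx : 0 < x)
    (h : x < (-1 + sqrt (1 + lam ^ 2)) / lam) : 0 < lam - 2 * x - lam * x ^ 2 := by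
  rw [lt_div_iff₀ hlam] at h
  have hS : sqrt (1 + lam ^ 2) ^ 2 = 1 + lam ^ 2 := sq_sqrt (by positivity)
  have h1 : (1 + lam * x) ^ 2 < sqrt (1 + lam ^ 2) ^ 2 :=
    pow_lt_pow_left₀ (by linarith) (by positivity) two_ne_zero
  rw [hS] at h1
  have h2 : 0 < lam * (lam - 2 * x - lam * x ^ 2) := by linarith
  exact pos_of_mul_pos_right h2 hlam.le

lemma quadratic_root_eq_zero {lam : ℝ} (hlam : 0 < lam) :
    lam - 2 * ((-1 + sqrt (1 + lam ^ 2)) / lam)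
      - lam * ((-1 + sqrt (1 + lam ^ 2)) / lam) ^ 2 = 0 := by
  have hS : sqrt (1 + lam ^ 2) ^ 2 = 1 + lam ^ 2 := sq_sqrt (by positivity)
  field_simp
  linear_combination -hS

lemma quadratic_nonneg_of_le_root {lam x : ℝ} (hlam : 0 < lam) (hx : 0 < x)
    (h : x ≤ (-1 + sqrt (1 + lam ^ 2)) / lam) : 0 ≤ lam - 2 * x - lam * x ^ 2 := by
  rcases h.lt_or_eq with h | rfl
  · exact (quadratic_pos_of_lt_root hlam hx h).le
  · exact (quadratic_root_eq_zero hlam).ge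

lemma hasDerivAt_arccos_of_sqrt_eq {g : ℝ → ℝ} {g' q x : ℝ} (hg : HasDerivAt g g' x)
    (hq : 0 < q) (h : 1 - g x ^ 2 = q ^ 2) :
    HasDerivAt (fun y => arccos (g y)) (-(g' / q)) x := by
  have hq2 : 0 < q ^ 2 := by positivity
  have h1 : g x ≠ -1 := fun e => by rw [e] at h; linarith
  have h2 : g x ≠ 1 := fun e => by rw [e] at h; linarith
  have := (hasDerivAt_arccos h1 h2).comp x hg
  rw [h, sqrt_sq hq.le] at this
  exact this.congr_deriv (by ring)

lemma hasDerivAt_arccos_affine {lam x : ℝ} (hlam : 0 < lam)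
    (hD : 0 < lam - 2 * x - lam * x ^ 2) :
    HasDerivAt (fun y => arccos ((1 + lam * y) / sqrt (1 + lam ^ 2)))
      (-(lam / sqrt (lam * (lam - 2 * x - lam * x ^ 2)))) x := by
  have hS : 0 < sqrt (1 + lam ^ 2) := by positivity
  have hS2 : sqrt (1 + lam ^ 2) ^ 2 = 1 + lam ^ 2 := sq_sqrt (by positivity)
  have hQ : 0 < sqrt (lam * (lam - 2 * x - lam * x ^ 2)) := by positivity
  have hQ2 : sqrt (lam * (lam - 2 * x - lam * x ^ 2)) ^ 2
      = lam * (lam - 2 * x - lam * x ^ 2) := sq_sqrt (by positivity)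
  have hg : HasDerivAt (fun y => (1 + lam * y) / sqrt (1 + lam ^ 2))
      (lam * 1 / sqrt (1 + lam ^ 2)) x :=
    (((hasDerivAt_id x).const_mul lam).const_add 1).div_const _
  convert hasDerivAt_arccos_of_sqrt_eq hg (div_pos hQ hS) ?_ using 1
  · field_simp
  · rw [div_pow, div_pow, hQ2, hS2]
    field_simp
    ring

lemma hasDerivAt_arccos_rational {lam x : ℝ} (hlam : 0 < lam) (hxl : x < lam)
    (hD : 0 < lam - 2 * x - lam * x ^ 2) :
    HasDerivAt (fun y => arccos (y * (1 + lam * y) / (lam - y)))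
      (-(lam * (1 + 2 * lam * x - x ^ 2) /
        ((lam - x) * sqrt (1 + x ^ 2) * sqrt (lam * (lam - 2 * x - lam * x ^ 2))))) x := by
  have hl : 0 < lam - x := sub_pos.2 hxl
  have hR : 0 < sqrt (1 + x ^ 2) := by positivity
  have hR2 : sqrt (1 + x ^ 2) ^ 2 = 1 + x ^ 2 := sq_sqrt (by positivity)
  have hQ : 0 < sqrt (lam * (lam - 2 * x - lam * x ^ 2)) := by positivity
  have hQ2 : sqrt (lam * (lam - 2 * x - lam * x ^ 2)) ^ 2
      = lam * (lam - 2 * x - lam * x ^ 2) := sq_sqrt (by positivity)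
  have hg : HasDerivAt (fun y => y * (1 + lam * y) / (lam - y))
      (((1 * (1 + lam * x) + x * (lam * 1)) * (lam - x) - x * (1 + lam * x) * -1) /
        (lam - x) ^ 2) x :=
    ((hasDerivAt_id x).mul (((hasDerivAt_id x).const_mul lam).const_add 1)).div
      ((hasDerivAt_id x).const_sub lam) hl.ne'
  refine (hasDerivAt_arccos_of_sqrt_eq hg (div_pos (mul_pos hQ hR) hl) ?_).congr_deriv ?_
  · rw [div_pow, div_pow, mul_pow (sqrt _), hQ2, hR2]
    field_simp
    ring
  · field_simp
    ring

lemma hasDerivAt_div_sqrt_one_add_sq (x : ℝ) :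
    HasDerivAt (fun y => 3 * y / (2 * sqrt (1 + y ^ 2))) (3 / (2 * sqrt (1 + x ^ 2) ^ 3)) x := by
  have hR : 0 < sqrt (1 + x ^ 2) := by positivity
  have hR2 : sqrt (1 + x ^ 2) ^ 2 = 1 + x ^ 2 := sq_sqrt (by positivity)
  have hs : HasDerivAt (fun y : ℝ => sqrt (1 + y ^ 2)) (2 * x / (2 * sqrt (1 + x ^ 2))) x := by
    have h : HasDerivAt (fun y : ℝ => 1 + y ^ 2) (2 * x) x := by
      simpa using (hasDerivAt_pow 2 x).const_add 1
    exact h.sqrt (by positivity)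
  have h : HasDerivAt (fun y => 3 * y / (2 * sqrt (1 + y ^ 2)))
      ((3 * 1 * (2 * sqrt (1 + x ^ 2)) - 3 * x * (2 * (2 * x / (2 * sqrt (1 + x ^ 2))))) /
        (2 * sqrt (1 + x ^ 2)) ^ 2) x :=
    ((hasDerivAt_id x).const_mul 3).div (hs.const_mul 2) (by positivity)
  refine h.congr_deriv ?_
  field_simp
  rw [hR2]
  ring

lemma derivative_bound_neg {lam x R Q a : ℝ} (hlam : 0 < lam) (hx : 0 < x) (hxl : x < lam)
    (hR : 0 < R) (hR2 : R ^ 2 = 1 + x ^ 2) (hQ : 0 < Q) (ha : 0 ≤ a)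
    (hD : 0 ≤ lam - 2 * x - lam * x ^ 2) :
    2 * -(lam / Q) - (3 / (2 * R ^ 3) * a + 3 * x / (2 * R) *
      -(lam * (1 + 2 * lam * x - x ^ 2) / ((lam - x) * R * Q))) < 0 := by
  have hl : 0 < lam - x := sub_pos.2 hxl
  have h1 : 0 ≤ 3 / (2 * R ^ 3) * a := by positivity
  have h2 : x * (1 + 2 * lam * x - x ^ 2) / ((lam - x) * R ^ 2) ≤ 1 := by
    rw [div_le_one (by positivity), hR2]
    linarith
  have h3 : 3 * x / (2 * R) * -(lam * (1 + 2 * lam * x - x ^ 2) / ((lam - x) * R * Q))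
      = -(3 / 2 * (lam / Q) * (x * (1 + 2 * lam * x - x ^ 2) / ((lam - x) * R ^ 2))) := by
    field_simp
  have h4 : 0 < lam / Q := by positivity
  rw [h3]
  nlinarith

theorem stmt_5 (lam : ℝ) (hlam : 0 < lam) :
    let xbar := (-1 + sqrt (1 + lam ^ 2)) / lam
    let f₁ := fun x : ℝ => arccos ((1 + lam * x) / sqrt (1 + lam ^ 2))
    let f₂ := fun x : ℝ => arccos (x * (1 + lam * x) / (lam - x))
    let t := fun x : ℝ => 2 * f₁ x - (3 * x / (2 * sqrt (1 + x ^ 2))) * f₂ x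
    StrictAntiOn t (Set.Ioc 0 xbar) ∧ t xbar = 0 ∧
      ∀ x ∈ Set.Ioo 0 xbar, (3 * x / (2 * sqrt (1 + x ^ 2))) * f₂ x < 2 * f₁ x := by
  intro xbar f₁ f₂ t
  have hS : 0 < sqrt (1 + lam ^ 2) := by positivity
  have hxbar : 0 < xbar := by
    refine div_pos ?_ hlam
    have : 1 < sqrt (1 + lam ^ 2) := lt_sqrt_of_sq_lt (by nlinarith)
    linarith
  have hlt : ∀ x ∈ Set.Ioc 0 xbar, x < lam := fun x hx => by
    have hD := quadratic_nonneg_of_le_root hlam hx.1 hx.2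
    have : 0 < lam * x ^ 2 := mul_pos hlam (pow_pos hx.1 2)
    linarith [hx.1]
  have hanti : StrictAntiOn t (Set.Ioc 0 xbar) := by
    refine strictAntiOn_of_deriv_neg (convex_Ioc 0 xbar) ?_ fun x hx => ?_
    · have h₁ : ContinuousOn f₁ (Set.Ioc 0 xbar) :=
        continuous_arccos.comp_continuousOn (by fun_prop)
      have h₂ : ContinuousOn f₂ (Set.Ioc 0 xbar) :=
        continuous_arccos.comp_continuousOn
          (ContinuousOn.div (by fun_prop) (by fun_prop) fun x hx => (sub_pos.2 (hlt x hx)).ne')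
      have h₃ : Continuous fun x : ℝ => 3 * x / (2 * sqrt (1 + x ^ 2)) :=
        continuous_iff_continuousAt.2 fun x => (hasDerivAt_div_sqrt_one_add_sq x).continuousAt
      exact (continuousOn_const.mul h₁).sub (h₃.continuousOn.mul h₂)
    · rw [interior_Ioc] at hx
      have hD := quadratic_pos_of_lt_root hlam hx.1 hx.2
      have hxl := hlt x ⟨hx.1, hx.2.le⟩
      have hd : HasDerivAt t _ x := ((hasDerivAt_arccos_affine hlam hD).const_mul 2).sub
        ((hasDerivAt_div_sqrt_one_add_sq x).mul (hasDerivAt_arccos_rational hlam hxl hD))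
      rw [hd.deriv]
      exact derivative_bound_neg hlam hx.1 hxl (by positivity) (sq_sqrt (by positivity))
        (by positivity) (arccos_nonneg _) hD.le
  have hzero : t xbar = 0 := by
    have h₁ : f₁ xbar = 0 := by
      have : (1 + lam * xbar) / sqrt (1 + lam ^ 2) = 1 := by
        rw [div_eq_one_iff_eq hS.ne', mul_div_cancel₀ _ hlam.ne']
        ring
      simp only [f₁, this, arccos_one]
    have h₂ : f₂ xbar = 0 := by
      have hl := sub_pos.2 (hlt xbar ⟨hxbar, le_rfl⟩)
      have hD : lam - 2 * xbar - lam * xbar ^ 2 = 0 := quadratic_root_eq_zero hlam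
      have : xbar * (1 + lam * xbar) / (lam - xbar) = 1 := by
        rw [div_eq_one_iff_eq hl.ne']
        linarith
      simp only [f₂, this, arccos_one]
    simp only [t, h₁, h₂, mul_zero, sub_zero]
  refine ⟨hanti, hzero, fun x hx => ?_⟩
  have h := hanti ⟨hx.1, hx.2.le⟩ ⟨hxbar, le_rfl⟩ hx.2
  rw [hzero] at h
  exact sub_pos.1 h
end

section
/- For every real number λ > 0, the function F(x) = arccos((1 + λ·g(x))/√(1 + λ²)), where g(x) = (−(1 + cos x) + √((1 + cos x)² + 4λ² cos x))/(2λ), is strictly increasing and strictly convex on the open interval (0, π/2). -/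
open Real

/-- The cosine of the half-length of the boundary arc, as a function of `c = cos x`
and of `L = √(1 + lam ^ 2)`. -/
noncomputable def cosHalfLength (L c : ℝ) : ℝ :=
  (1 - c + √((1 - c) ^ 2 + 4 * L ^ 2 * c)) / (2 * L)

/-- The square of the derivative of the half-length, as a function of its cosine `u`. -/
noncomputable def sqSlope (L u : ℝ) : ℝ :=
  (L - u) ^ 2 / L * ((L * (1 + u ^ 2) - 2 * u) / (2 * L * u - 1 - u ^ 2) ^ 2)

section

variable {L c : ℝ}

lemma one_lt_mul_cosHalfLength (hL : 1 < L) (hc : 0 < c) : 1 < L * cosHalfLength L c := by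
  have hR : 1 + c < √((1 - c) ^ 2 + 4 * L ^ 2 * c) := by
    apply lt_sqrt_of_sq_lt
    nlinarith [mul_pos hc (show 0 < L ^ 2 - 1 by nlinarith)]
  have h : L * cosHalfLength L c = (1 - c + √((1 - c) ^ 2 + 4 * L ^ 2 * c)) / 2 := by
    unfold cosHalfLength
    field_simp
  linarith

lemma cosHalfLength_lt_one (hL : 1 < L) (hc : 0 < c) (hc1 : c < 1) : cosHalfLength L c < 1 := by
  have hR : √((1 - c) ^ 2 + 4 * L ^ 2 * c) < 2 * L - (1 - c) := by
    rw [sqrt_lt' (by linarith)]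
    nlinarith [mul_pos (mul_pos (show 0 < L by linarith) (sub_pos.2 hL)) (sub_pos.2 hc1)]
  rw [cosHalfLength, div_lt_one (by linarith)]
  linarith

lemma sqrt_eq_cosHalfLength (hL : 1 < L) :
    √((1 - c) ^ 2 + 4 * L ^ 2 * c) = 2 * L * cosHalfLength L c - (1 - c) := by
  unfold cosHalfLength
  field_simp
  ring

lemma cosHalfLength_quadratic (hL : 1 < L) (hc : 0 < c) :
    cosHalfLength L c * (L * cosHalfLength L c - 1) = c * (L - cosHalfLength L c) := by
  have h := sq_sqrt (show 0 ≤ (1 - c) ^ 2 + 4 * L ^ 2 * c by positivity)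
  rw [sqrt_eq_cosHalfLength hL] at h
  have hL0 : 4 * L ≠ 0 := by linarith
  apply mul_left_cancel₀ hL0
  linear_combination h

lemma hasDerivAt_cosHalfLength (hL : 1 < L) (hc : 0 < c) :
    HasDerivAt (cosHalfLength L)
      ((L - cosHalfLength L c) / (2 * L * cosHalfLength L c - (1 - c))) c := by
  have hpos : 0 < (1 - c) ^ 2 + 4 * L ^ 2 * c := by positivity
  have h1 : HasDerivAt (fun c : ℝ => 1 - c) (-1) c := by
    simpa using (hasDerivAt_id c).const_sub 1
  have h2 : HasDerivAt (fun c : ℝ => 4 * L ^ 2 * c) (4 * L ^ 2) c := by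
    simpa using (hasDerivAt_id c).const_mul (4 * L ^ 2)
  have h3 := (h1.add (((h1.pow 2).add h2).sqrt hpos.ne')).div_const (2 * L)
  refine h3.congr_deriv ?_
  have hR : 0 < √((1 - c) ^ 2 + 4 * L ^ 2 * c) := sqrt_pos.2 hpos
  simp only [Pi.add_apply, Pi.pow_apply]
  have hu := sqrt_eq_cosHalfLength (c := c) hL
  rw [← hu]
  generalize √((1 - c) ^ 2 + 4 * L ^ 2 * c) = R at *
  field_simp
  push_cast
  linear_combination -2 * hu

lemma strictAntiOn_sqSlope (hL : 1 < L) : StrictAntiOn (sqSlope L) (Set.Ioo (1 / L) 1) := by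
  have hL0 : 0 < L := by linarith
  have hlow {u : ℝ} (hu : u ∈ Set.Ioo (1 / L) 1) : 1 < L * u := by
    have := (div_lt_iff₀ hL0).1 hu.1
    linarith
  have hD {u : ℝ} (hu : u ∈ Set.Ioo (1 / L) 1) : 0 < 2 * L * u - 1 - u ^ 2 := by
    have h0 : 0 < u := lt_trans (by positivity) hu.1
    nlinarith [hlow hu, hu.2]
  have hderiv {u : ℝ} (hu : u ∈ Set.Ioo (1 / L) 1) :
      HasDerivAt (fun u : ℝ => (L * (1 + u ^ 2) - 2 * u) / (2 * L * u - 1 - u ^ 2) ^ 2)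
        (-2 * (2 * L ^ 2 - 3 * L * u + 3 * u ^ 2 - L * u ^ 3 - 1) /
          (2 * L * u - 1 - u ^ 2) ^ 3) u := by
    have hid := hasDerivAt_id u
    have hsq := hid.pow 2
    have h1 := ((hsq.const_add 1).const_mul L).sub (hid.const_mul 2)
    have h2 := (((hid.const_mul (2 * L)).sub_const 1).sub hsq).pow 2
    have h := h1.div h2 (pow_pos (hD hu) 2).ne'
    refine h.congr_deriv ?_
    have := hD hu
    simp only [Pi.sub_apply, Pi.pow_apply, id]
    rw [div_eq_div_iff (by positivity) (by positivity)]
    push_cast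
    ring
  have hanti : AntitoneOn (fun u : ℝ => (L * (1 + u ^ 2) - 2 * u) / (2 * L * u - 1 - u ^ 2) ^ 2)
      (Set.Ioo (1 / L) 1) := by
    apply antitoneOn_of_deriv_nonpos (convex_Ioo _ _)
    · exact fun u hu => (hderiv hu).continuousAt.continuousWithinAt
    · rw [interior_Ioo]
      exact fun u hu => (hderiv hu).differentiableAt.differentiableWithinAt
    · rw [interior_Ioo]
      intro u hu
      rw [(hderiv hu).deriv]
      have h0 : 0 < u := lt_trans (by positivity) hu.1
      have h1 : 0 ≤ 1 - u := by linarith [hu.2]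
      have hnum : 0 ≤ 2 * L ^ 2 - 3 * L * u + 3 * u ^ 2 - L * u ^ 3 - 1 := by
        have key : 2 * L ^ 2 - 3 * L * u + 3 * u ^ 2 - L * u ^ 3 - 1 =
            2 * (L - 1) ^ 2 + (L - 1) * ((1 - u) * (4 + u + u ^ 2)) + (1 - u) ^ 3 := by
          ring
        rw [key]
        have : 0 ≤ L - 1 := by linarith
        positivity
      exact div_nonpos_of_nonpos_of_nonneg (by linarith) (pow_pos (hD hu) 3).le
  intro a ha b hb hab
  have hN : 0 < L * (1 + a ^ 2) - 2 * a := by nlinarith [sq_nonneg (a - 1)]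
  have hlt : (L - b) ^ 2 / L < (L - a) ^ 2 / L := by
    have := hb.2
    gcongr
    linarith
  have hpos : 0 < (L * (1 + a ^ 2) - 2 * a) / (2 * L * a - 1 - a ^ 2) ^ 2 :=
    div_pos hN (pow_pos (hD ha) 2)
  exact (mul_le_mul_of_nonneg_left (hanti ha hb hab.le) (by positivity)).trans_lt
    (mul_lt_mul_of_pos_right hlt hpos)

/-- The derivative of the half-length at `x`. -/
lemma hasDerivAt_arccos_cosHalfLength (hL : 1 < L) {x : ℝ} (hx : x ∈ Set.Ioo 0 (π / 2)) :
    HasDerivAt (fun x => arccos (cosHalfLength L (cos x)))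
      (√(sqSlope L (cosHalfLength L (cos x)))) x := by
  have hc : 0 < cos x := cos_pos_of_mem_Ioo ⟨by linarith [hx.1, pi_pos], hx.2⟩
  have hs : 0 < sin x := sin_pos_of_pos_of_lt_pi hx.1 (by linarith [hx.2, pi_pos])
  have hc1 : cos x < 1 := by nlinarith [sin_sq_add_cos_sq x]
  have hlow := one_lt_mul_cosHalfLength hL hc
  have hhigh := cosHalfLength_lt_one hL hc hc1
  have hq := cosHalfLength_quadratic hL hc
  have hC := (hasDerivAt_cosHalfLength hL hc).comp x (hasDerivAt_cos x)
  have hpos : 0 < cosHalfLength L (cos x) := by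
    by_contra! h
    nlinarith
  have h := (hasDerivAt_arccos (by linarith) hhigh.ne).comp x hC
  refine h.congr_deriv (Eq.symm ?_)
  have hsc := sin_sq_add_cos_sq x
  generalize cosHalfLength L (cos x) = u at *
  have hR : 0 < 2 * L * u - (1 - cos x) := by linarith
  have hLu : 0 < L - u := by linarith
  have hW : 0 < 1 - u ^ 2 := by nlinarith
  have hD : 0 < 2 * L * u - 1 - u ^ 2 := by nlinarith
  have hcos : cos x = u * (L * u - 1) / (L - u) := by
    rw [eq_div_iff hLu.ne', hq]
  rw [sqrt_eq_iff_mul_self_eq_of_pos]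
  · have hssq : sin x ^ 2 = 1 - cos x ^ 2 := by linarith
    have hsin : sin x ^ 2 = L * (1 - u ^ 2) * (L * (1 + u ^ 2) - 2 * u) / (L - u) ^ 2 := by
      rw [hssq, hcos]
      field_simp
      ring
    have hR' : 2 * L * u - (1 - cos x) = L * (2 * L * u - 1 - u ^ 2) / (L - u) := by
      rw [hcos]
      field_simp
      ring
    have hsq : √(1 - u ^ 2) ^ 2 = 1 - u ^ 2 := sq_sqrt hW.le
    rw [hR', sqSlope]
    calc _ = sin x ^ 2 * ((L - u) / (L * (2 * L * u - 1 - u ^ 2) / (L - u))) ^ 2 /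
          √(1 - u ^ 2) ^ 2 := by ring
      _ = _ := by
        rw [hsin, hsq]
        field_simp
  · have := sqrt_pos.2 hW
    have : 0 < 1 / √(1 - u ^ 2) * ((L - u) / (2 * L * u - (1 - cos x)) * sin x) := by positivity
    linarith

end

theorem stmt_6 (lam : ℝ) (hlam : 0 < lam) :
    let g := fun x : ℝ =>
      (-(1 + cos x) + sqrt ((1 + cos x) ^ 2 + 4 * lam ^ 2 * cos x)) / (2 * lam)
    let F := fun x : ℝ => arccos ((1 + lam * g x) / sqrt (1 + lam ^ 2))
    StrictMonoOn F (Set.Ioo 0 (π / 2)) ∧ StrictConvexOn ℝ (Set.Ioo 0 (π / 2)) F := by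
  intro g F
  set L := √(1 + lam ^ 2) with hLdef
  have hLsq : L ^ 2 = 1 + lam ^ 2 := sq_sqrt (by positivity)
  have hL : 1 < L := lt_sqrt_of_sq_lt (by nlinarith)
  have hF : F = fun x => arccos (cosHalfLength L (cos x)) := by
    funext x
    have hrad : (1 + cos x) ^ 2 + 4 * lam ^ 2 * cos x =
        (1 - cos x) ^ 2 + 4 * L ^ 2 * cos x := by
      rw [hLsq]
      ring
    simp only [F, g, cosHalfLength, hrad]
    congr 1
    field_simp
    ring
  have hderiv {x : ℝ} (hx : x ∈ Set.Ioo 0 (π / 2)) :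
      HasDerivAt F (√(sqSlope L (cosHalfLength L (cos x)))) x :=
    hF ▸ hasDerivAt_arccos_cosHalfLength hL hx
  have hcont : ContinuousOn F (Set.Ioo 0 (π / 2)) :=
    fun x hx => (hderiv hx).continuousAt.continuousWithinAt
  have hcos {x : ℝ} (hx : x ∈ Set.Ioo 0 (π / 2)) : cos x ∈ Set.Ioo (0 : ℝ) 1 := by
    refine ⟨cos_pos_of_mem_Ioo ⟨by linarith [hx.1, pi_pos], hx.2⟩, ?_⟩
    simpa using cos_lt_cos_of_nonneg_of_le_pi_div_two le_rfl hx.2.le hx.1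
  have hmem {c : ℝ} (hc : c ∈ Set.Ioo (0 : ℝ) 1) : cosHalfLength L c ∈ Set.Ioo (1 / L) 1 := by
    refine ⟨?_, cosHalfLength_lt_one hL hc.1 hc.2⟩
    rw [div_lt_iff₀ (by linarith), mul_comm]
    exact one_lt_mul_cosHalfLength hL hc.1
  have hmono : StrictMonoOn (cosHalfLength L) (Set.Ioo 0 1) := by
    apply strictMonoOn_of_deriv_pos (convex_Ioo _ _)
    · exact fun c hc => (hasDerivAt_cosHalfLength hL hc.1).continuousAt.continuousWithinAt
    · rw [interior_Ioo]
      intro c hc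
      rw [(hasDerivAt_cosHalfLength hL hc.1).deriv]
      have h1 := one_lt_mul_cosHalfLength hL hc.1
      have h2 := cosHalfLength_lt_one hL hc.1 hc.2
      have h3 := hc.1
      exact div_pos (by linarith) (by linarith)
  have hpos {u : ℝ} (hu : u ∈ Set.Ioo (1 / L) 1) : 0 < sqSlope L u := by
    have h1 : 1 < L * u := by
      have := (div_lt_iff₀ (by linarith)).1 hu.1
      linarith
    have h2 : 0 < L - u := by linarith [hu.2]
    have h3 : 0 < L * (1 + u ^ 2) - 2 * u := by nlinarith [sq_nonneg (u - 1)]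
    have h0 : 0 < u := lt_trans (by positivity) hu.1
    have h4 : 0 < 2 * L * u - 1 - u ^ 2 := by nlinarith [hu.2]
    unfold sqSlope
    positivity
  constructor
  · apply strictMonoOn_of_deriv_pos (convex_Ioo _ _) hcont
    rw [interior_Ioo]
    intro x hx
    rw [(hderiv hx).deriv]
    exact sqrt_pos.2 (hpos (hmem (hcos hx)))
  · apply StrictMonoOn.strictConvexOn_of_deriv (convex_Ioo _ _) hcont
    rw [interior_Ioo]
    intro x hx y hy hxy
    rw [(hderiv hx).deriv, (hderiv hy).deriv]
    have hlt : cos y < cos x := cos_lt_cos_of_nonneg_of_le_pi_div_two hx.1.le hy.2.le hxy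
    exact sqrt_lt_sqrt (hpos (hmem (hcos hx))).le
      (strictAntiOn_sqSlope hL (hmem (hcos hy)) (hmem (hcos hx))
        (hmono (hcos hy) (hcos hx) hlt))
end

section
/- For every real number λ > 0, the function g(φ) = (−(1 + cos φ) + √((1 + cos φ)² + 4λ² cos φ))/(2λ) is strictly decreasing on (0, π/2), and for every φ ∈ (0, π/2) one has 0 < g(φ) < (−1 + √(1 + λ²))/λ. -/
open Real

theorem strictMonoOn_neg_one_add_add_sqrt {lam : ℝ} (hlam : 0 < lam) :
    StrictMonoOn (fun c : ℝ => -(1 + c) + sqrt ((1 + c) ^ 2 + 4 * lam ^ 2 * c)) (Set.Ici 0) := by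
  intro a ha b _ hab
  have ha : 0 ≤ a := ha
  have hl : 0 < lam ^ 2 := by positivity
  have hs : sqrt ((1 + a) ^ 2 + 4 * lam ^ 2 * a) < 1 + a + 2 * lam ^ 2 := by
    rw [sqrt_lt' (by positivity)]
    nlinarith [sq_nonneg (lam ^ 2)]
  have hsq : sqrt ((1 + a) ^ 2 + 4 * lam ^ 2 * a) ^ 2 = (1 + a) ^ 2 + 4 * lam ^ 2 * a :=
    sq_sqrt (by positivity)
  have hlt : sqrt ((1 + a) ^ 2 + 4 * lam ^ 2 * a) + (b - a) <
      sqrt ((1 + b) ^ 2 + 4 * lam ^ 2 * b) := by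
    apply lt_sqrt_of_sq_lt
    nlinarith [mul_pos (sub_pos.2 hab) (sub_pos.2 hs)]
  change -(1 + a) + _ < -(1 + b) + _
  linarith

theorem stmt_7 (lam : ℝ) (hlam : 0 < lam) :
    let g := fun φ : ℝ =>
      (-(1 + cos φ) + sqrt ((1 + cos φ) ^ 2 + 4 * lam ^ 2 * cos φ)) / (2 * lam)
    StrictAntiOn g (Set.Ioo 0 (π / 2)) ∧
      ∀ φ ∈ Set.Ioo 0 (π / 2), 0 < g φ ∧ g φ < (-1 + sqrt (1 + lam ^ 2)) / lam := by
  intro g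
  have hmono := strictMonoOn_neg_one_add_add_sqrt hlam
  have hcos : ∀ φ ∈ Set.Ioo 0 (π / 2), 0 < cos φ := fun φ hφ =>
    cos_pos_of_mem_Ioo ⟨by linarith [hφ.1, pi_pos], hφ.2⟩
  refine ⟨fun x hx y hy hxy => ?_, fun φ hφ => ⟨?_, ?_⟩⟩
  · have hlt : cos y < cos x := cos_lt_cos_of_nonneg_of_le_pi_div_two hx.1.le hy.2.le hxy
    exact div_lt_div_of_pos_right (hmono (hcos y hy).le (hcos x hx).le hlt) (by positivity)
  · have h := hmono Set.self_mem_Ici (hcos φ hφ).le (hcos φ hφ)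
    norm_num at h
    exact div_pos (by linarith) (by positivity)
  · have hlt : cos φ < 1 := by
      simpa using cos_lt_cos_of_nonneg_of_le_pi_div_two le_rfl hφ.2.le hφ.1
    have h := hmono (hcos φ hφ).le (Set.mem_Ici.2 zero_le_one) hlt
    have hsqrt : sqrt ((1 + 1) ^ 2 + 4 * lam ^ 2 * 1) = 2 * sqrt (1 + lam ^ 2) := by
      rw [show ((1 : ℝ) + 1) ^ 2 + 4 * lam ^ 2 * 1 = 2 ^ 2 * (1 + lam ^ 2) by ring,
        sqrt_mul (by positivity), sqrt_sq (by positivity)]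
    have hval : (-1 + sqrt (1 + lam ^ 2)) / lam =
        (-(1 + 1) + sqrt ((1 + 1) ^ 2 + 4 * lam ^ 2 * 1)) / (2 * lam) := by
      rw [hsqrt]
      field_simp
      ring
    rw [hval]
    exact div_lt_div_of_pos_right h (by positivity)
end

section
/- Fix λ > 0 and define F(φ) = arccos((1 + λ·g(φ))/√(1 + λ²)), where g(φ) = (−(1 + cos φ) + √((1 + cos φ)² + 4λ² cos φ))/(2λ). Then for all natural numbers k, n with 3 ≤ k ≤ n, one has n·F(π/n) ≤ k·F(π/k), with strict inequality whenever k < n. (Here 2m·F(π/m) is the perimeter of the regular spherical m-gon of thickness arctan λ, so the regular spherical n-gon has minimal perimeter among all regular spherical k-gons of thickness arctan λ with k ≤ n.) -/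
open Real

/-- The cosine of the half central angle of a regular spherical polygon whose thickness has
cosine `t`, in terms of the cosine `x` of its half side. -/
noncomputable def cosAngle (t x : ℝ) : ℝ := x * (x - t) / (1 - t * x)

lemma cosAngle_lt_cosAngle {t x y : ℝ} (ht0 : 0 < t) (ht1 : t < 1) (htx : t ≤ x) (hxy : x < y)
    (hy : y ≤ 1) : cosAngle t x < cosAngle t y := by
  unfold cosAngle
  have hx : 0 < 1 - t * x := by nlinarith
  have hy' : 0 < 1 - t * y := by nlinarith
  rw [div_lt_div_iff₀ hx hy']
  have hpos : 0 < x + y - t - t * x * y := by nlinarith [mul_nonneg ht0.le (sub_nonneg.2 hy)]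
  nlinarith [mul_pos (sub_pos.2 hxy) hpos]

lemma cosAngle_mem_Ico {t x : ℝ} (ht0 : 0 < t) (ht1 : t < 1) (htx : t ≤ x) (hx : x < 1) :
    cosAngle t x ∈ Set.Ico 0 1 := by
  have hd : 0 < 1 - t * x := by nlinarith
  refine ⟨div_nonneg (mul_nonneg (by linarith) (by linarith)) hd.le, ?_⟩
  have h := cosAngle_lt_cosAngle ht0 ht1 htx hx le_rfl
  have h1 : cosAngle t 1 = 1 := by
    unfold cosAngle
    rw [mul_one, one_mul, div_self (by linarith)]
  rwa [h1] at h

/-- The square of the derivative of the half central angle with respect to the half side `θ`,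
as a function of `x = cos θ`, is strictly increasing. -/
lemma strictMonoOn_angle_deriv_sq {t : ℝ} (ht0 : 0 < t) (ht1 : t < 1) :
    StrictMonoOn (fun x : ℝ => (2 * x - t - t * x ^ 2) ^ 2 /
      ((1 - t * x) ^ 2 * (1 - 2 * t * x + x ^ 2))) (Set.Icc t 1) := by
  have hD : ∀ x ∈ Set.Icc t 1, 0 < 1 - t * x := fun x hx => by nlinarith [hx.1, hx.2]
  have hE : ∀ x ∈ Set.Icc t 1, 0 < 1 - 2 * t * x + x ^ 2 := fun x hx => by
    nlinarith [hx.1, hx.2, sq_nonneg (x - t), mul_pos ht0 ht0]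
  apply strictMonoOn_of_deriv_pos (convex_Icc t 1)
  · refine ContinuousOn.div (by fun_prop) (by fun_prop) fun x hx => ?_
    have := hD x hx
    have := hE x hx
    positivity
  · intro x hx
    rw [interior_Icc] at hx
    have hx' : x ∈ Set.Icc t 1 := Set.Ioo_subset_Icc_self hx
    have hd := hD x hx'
    have he := hE x hx'
    obtain ⟨htx, hx1⟩ := hx
    have hN : 0 < 2 * x - t - t * x ^ 2 := by nlinarith [mul_pos ht0 (sub_pos.2 hx1)]
    have hnum : HasDerivAt (fun x : ℝ => 2 * x - t - t * x ^ 2) (2 * (1 - t * x)) x := by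
      refine ((((hasDerivAt_id x).const_mul 2).sub_const t).sub
        ((hasDerivAt_pow 2 x).const_mul t)).congr_deriv ?_
      push_cast
      ring
    have hden : HasDerivAt (fun x : ℝ => 1 - t * x) (-t) x := by
      exact (((hasDerivAt_id x).const_mul t).const_sub 1).congr_deriv (by ring)
    have hrad : HasDerivAt (fun x : ℝ => 1 - 2 * t * x + x ^ 2) (2 * (x - t)) x := by
      refine ((((hasDerivAt_id x).const_mul (2 * t)).const_sub 1).add
        (hasDerivAt_pow 2 x)).congr_deriv ?_
      push_cast
      ring
    have h := (hnum.pow 2).div ((hden.pow 2).mul hrad) (by simp; constructor <;> positivity)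
    refine lt_of_lt_of_eq ?_ h.deriv.symm
    simp only [Pi.mul_apply, Pi.pow_apply]
    refine div_pos ?_ (by positivity)
    have hxt : x - t ≤ 1 - t * x := by nlinarith
    have hNE : 2 * x - t - t * x ^ 2 ≤ 2 * (1 - 2 * t * x + x ^ 2) := by
      nlinarith [mul_nonneg ht0.le (sq_nonneg (x - 1)), sq_nonneg (2 * x - 1),
        mul_nonneg (sub_nonneg.2 ht1.le) (sq_nonneg (2 * x - 1))]
    have hkey : (2 * x - t - t * x ^ 2) * (x - t) ≤
        2 * (1 - 2 * t * x + x ^ 2) * (1 - t * x) :=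
      mul_le_mul hNE hxt (by linarith) (by positivity)
    have hpos : 0 < (1 - t * x) * (2 * (1 - 2 * t * x + x ^ 2) * (1 - t * x) -
        (2 * x - t - t * x ^ 2) * (x - t)) +
        t * (2 * x - t - t * x ^ 2) * (1 - 2 * t * x + x ^ 2) :=
      add_pos_of_nonneg_of_pos (mul_nonneg hd.le (sub_nonneg.2 hkey)) (by positivity)
    refine lt_of_lt_of_eq (mul_pos (mul_pos (mul_pos two_pos hN) hd) hpos) ?_
    push_cast
    ring

lemma hasDerivAt_arccos_cosAngle_cos {t θ : ℝ} (ht0 : 0 < t) (ht1 : t < 1) (hθ0 : 0 < θ)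
    (hθ : θ < arccos t) :
    HasDerivAt (fun θ => arccos (cosAngle t (cos θ)))
      ((2 * cos θ - t - t * cos θ ^ 2) /
        ((1 - t * cos θ) * sqrt (1 - 2 * t * cos θ + cos θ ^ 2))) θ := by
  have hθπ : θ < π := hθ.trans_le (arccos_le_pi t)
  have hs : 0 < sin θ := sin_pos_of_pos_of_lt_pi hθ0 hθπ
  have hx1 : cos θ < 1 := by
    simpa using cos_lt_cos_of_nonneg_of_le_pi le_rfl hθπ.le hθ0
  have htx : t < cos θ := by
    have := cos_lt_cos_of_nonneg_of_le_pi hθ0.le (arccos_le_pi t) hθ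
    rwa [cos_arccos (by linarith) ht1.le] at this
  have hd : 0 < 1 - t * cos θ := by nlinarith
  have he : 0 < 1 - 2 * t * cos θ + cos θ ^ 2 := by
    nlinarith [sq_nonneg (cos θ - t), mul_pos ht0 ht0]
  obtain ⟨hq0, hq1⟩ := cosAngle_mem_Ico ht0 ht1 htx.le hx1
  have hsc : sin θ ^ 2 = 1 - cos θ ^ 2 := sin_sq θ
  have hsqrt : sqrt (1 - cosAngle t (cos θ) ^ 2) =
      sin θ * sqrt (1 - 2 * t * cos θ + cos θ ^ 2) / (1 - t * cos θ) := by
    have hsq : 1 - cosAngle t (cos θ) ^ 2 =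
        (sin θ * sqrt (1 - 2 * t * cos θ + cos θ ^ 2) / (1 - t * cos θ)) ^ 2 := by
      rw [div_pow, mul_pow, sq_sqrt he.le, hsc, cosAngle, div_pow,
        eq_div_iff (by positivity), sub_mul, div_mul_cancel₀ _ (by positivity)]
      ring
    rw [hsq, sqrt_sq (by positivity)]
  have hc := hasDerivAt_cos θ
  have hq : HasDerivAt (fun θ => cosAngle t (cos θ))
      (-(sin θ * (2 * cos θ - t - t * cos θ ^ 2) / (1 - t * cos θ) ^ 2)) θ := by
    unfold cosAngle
    refine ((hc.mul (hc.sub_const t)).div ((hc.const_mul t).const_sub 1) hd.ne').congr_deriv ?_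
    simp only [Pi.mul_apply]
    field_simp
    ring
  have h := (hasDerivAt_arccos (by linarith) hq1.ne).comp θ hq
  refine h.congr_deriv ?_
  rw [hsqrt]
  have := sqrt_pos.2 he
  field_simp

lemma strictConcaveOn_arccos_cosAngle_cos {t : ℝ} (ht0 : 0 < t) (ht1 : t < 1) :
    StrictConcaveOn ℝ (Set.Icc 0 (arccos t)) (fun θ => arccos (cosAngle t (cos θ))) := by
  apply StrictAntiOn.strictConcaveOn_of_deriv (convex_Icc _ _)
  · refine continuous_arccos.comp_continuousOn ?_
    unfold cosAngle
    refine ContinuousOn.div (by fun_prop) (by fun_prop) fun θ _ => ?_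
    nlinarith [cos_le_one θ]
  · rw [interior_Icc]
    intro a ha b hb hab
    rw [(hasDerivAt_arccos_cosAngle_cos ht0 ht1 ha.1 ha.2).deriv,
      (hasDerivAt_arccos_cosAngle_cos ht0 ht1 hb.1 hb.2).deriv]
    have hmem : ∀ θ ∈ Set.Ioo 0 (arccos t), cos θ ∈ Set.Icc t 1 := fun θ hθ => by
      refine ⟨?_, cos_le_one θ⟩
      have := cos_le_cos_of_nonneg_of_le_pi hθ.1.le (arccos_le_pi t) hθ.2.le
      rwa [cos_arccos (by linarith) ht1.le] at this
    have hcos : cos b < cos a :=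
      cos_lt_cos_of_nonneg_of_le_pi ha.1.le (hb.2.le.trans (arccos_le_pi t)) hab
    have h := strictMonoOn_angle_deriv_sq ht0 ht1 (hmem b hb) (hmem a ha) hcos
    have hE : ∀ x ∈ Set.Icc t 1, 0 ≤ 1 - 2 * t * x + x ^ 2 := fun x hx => by
      nlinarith [hx.1, hx.2, sq_nonneg (x - t)]
    have hx := hmem a ha
    have hN : 0 ≤ 2 * cos a - t - t * cos a ^ 2 := by
      nlinarith [hx.1, mul_nonneg ht0.le (sub_nonneg.2 hx.2)]
    have hd : 0 ≤ 1 - t * cos a := by nlinarith [hx.2]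
    refine lt_of_pow_lt_pow_left₀ 2 (by positivity) ?_
    rw [div_pow, div_pow, mul_pow, mul_pow, sq_sqrt (hE _ (hmem a ha)), sq_sqrt (hE _ (hmem b hb))]
    exact h

/-- The cosine `x` of the half side, computed from the cosine `c` of the half central angle. -/
lemma cosAngle_halfSide {lam c : ℝ} (hlam : 0 < lam) (hc0 : 0 < c) (hc1 : c < 1) :
    let t := 1 / sqrt (1 + lam ^ 2)
    let x := (1 + lam * ((-(1 + c) + sqrt ((1 + c) ^ 2 + 4 * lam ^ 2 * c)) / (2 * lam))) /
      sqrt (1 + lam ^ 2)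
    t < x ∧ x < 1 ∧ cosAngle t x = c := by
  have hs2 : sqrt (1 + lam ^ 2) ^ 2 = 1 + lam ^ 2 := sq_sqrt (by positivity)
  have hr2 : sqrt ((1 + c) ^ 2 + 4 * lam ^ 2 * c) ^ 2 = (1 + c) ^ 2 + 4 * lam ^ 2 * c :=
    sq_sqrt (by positivity)
  have hs0 := sqrt_nonneg (1 + lam ^ 2)
  have hr0 := sqrt_nonneg ((1 + c) ^ 2 + 4 * lam ^ 2 * c)
  generalize sqrt (1 + lam ^ 2) = s at *
  generalize sqrt ((1 + c) ^ 2 + 4 * lam ^ 2 * c) = r at *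
  intro t x
  have hl2 : 0 < lam ^ 2 := by positivity
  have hs1 : 1 < s := by nlinarith
  have hrc : 1 + c < r := by nlinarith [mul_pos hl2 hc0]
  have hrs : r < 2 * s - 1 + c := by
    refine lt_of_pow_lt_pow_left₀ 2 (by linarith) ?_
    have := mul_pos (mul_pos (by linarith : 0 < s) (sub_pos.2 hs1)) (sub_pos.2 hc1)
    rw [hr2]
    nlinarith
  have hx : x = ((1 - c + r) / 2) / s := by
    simp only [x]
    congr 1
    field_simp
    ring
  have htx : t < x := by
    rw [hx]
    exact div_lt_div_of_pos_right (by linarith) (by linarith)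
  have hx1 : x < 1 := by
    rw [hx, div_lt_one (by linarith)]
    linarith
  refine ⟨htx, hx1, ?_⟩
  have ht0 : 0 < t := by positivity
  have ht1 : t < 1 := (div_lt_one (by linarith)).2 hs1
  have hd : 0 < 1 - t * x := by nlinarith
  rw [cosAngle, div_eq_iff hd.ne', hx]
  have hsne : s ≠ 0 := by linarith
  simp only [t]
  field_simp
  nlinarith

theorem stmt_9 (lam : ℝ) (hlam : 0 < lam) :
    let g := fun φ : ℝ =>
      (-(1 + cos φ) + sqrt ((1 + cos φ) ^ 2 + 4 * lam ^ 2 * cos φ)) / (2 * lam)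
    let F := fun φ : ℝ => arccos ((1 + lam * g φ) / sqrt (1 + lam ^ 2))
    ∀ k n : ℕ, 3 ≤ k → k ≤ n →
      (n : ℝ) * F (π / n) ≤ (k : ℝ) * F (π / k) ∧
        (k < n → (n : ℝ) * F (π / n) < (k : ℝ) * F (π / k)) := by
  intro g F
  set t := 1 / sqrt (1 + lam ^ 2) with ht
  have hs1 : 1 < sqrt (1 + lam ^ 2) := by
    rw [lt_sqrt zero_le_one]
    nlinarith [mul_pos hlam hlam]
  have ht0 : 0 < t := by positivity
  have ht1 : t < 1 := (div_lt_one (by linarith)).2 hs1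
  have hF : ∀ φ : ℝ, 0 < φ → φ < π / 2 → F φ ∈ Set.Ioo 0 (arccos t) ∧
      arccos (cosAngle t (cos (F φ))) = φ := by
    intro φ h0 h1
    have hc0 : 0 < cos φ := cos_pos_of_mem_Ioo ⟨by linarith, h1⟩
    have hc1 : cos φ < 1 := by
      simpa using cos_lt_cos_of_nonneg_of_le_pi le_rfl (by linarith) h0
    obtain ⟨htx, hx1, hq⟩ := cosAngle_halfSide hlam hc0 hc1
    refine ⟨⟨arccos_pos.2 hx1, arccos_lt_arccos (by linarith) htx hx1.le⟩, ?_⟩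
    have hcos : cos (F φ) = _ := cos_arccos (by linarith) hx1.le
    rw [hcos, hq, arccos_cos h0.le (by linarith)]
  have hstrict : ∀ k n : ℕ, 3 ≤ k → k < n → (n : ℝ) * F (π / n) < (k : ℝ) * F (π / k) := by
    intro k n hk hkn
    have hk' : (3 : ℝ) ≤ k := by exact_mod_cast hk
    have hkn' : (k : ℝ) < n := by exact_mod_cast hkn
    have hπ := pi_pos
    have hangle : π / n < π / k := div_lt_div_of_pos_left hπ (by linarith) hkn'
    have hk2 : π / k < π / 2 := div_lt_div_of_pos_left hπ two_pos (by linarith)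
    have hn0 : 0 < π / n := div_pos hπ (by linarith)
    obtain ⟨⟨ha0, ha1⟩, ha⟩ := hF _ hn0 (hangle.trans hk2)
    obtain ⟨⟨hb0, hb1⟩, hb⟩ := hF _ (hn0.trans hangle) hk2
    set a := F (π / n)
    set b := F (π / k)
    have hab : a < b := by
      by_contra! hba
      have hcosa : t ≤ cos a := by
        have := cos_le_cos_of_nonneg_of_le_pi ha0.le (arccos_le_pi t) ha1.le
        rwa [cos_arccos (by linarith) ht1.le] at this
      have hcos := cos_le_cos_of_nonneg_of_le_pi hb0.le (ha1.le.trans (arccos_le_pi t)) hba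
      have hq : cosAngle t (cos a) ≤ cosAngle t (cos b) := by
        rcases hcos.eq_or_lt with h | h
        · rw [h]
        · exact (cosAngle_lt_cosAngle ht0 ht1 hcosa h (cos_le_one b)).le
      have := arccos_le_arccos hq
      rw [ha, hb] at this
      linarith
    have hzero : arccos (cosAngle t (cos 0)) = 0 := by
      rw [cos_zero, cosAngle, mul_one, one_mul, div_self (by linarith), arccos_one]
    have hconc := (strictConcaveOn_arccos_cosAngle_cos ht0 ht1).2
      (Set.left_mem_Icc.2 (arccos_nonneg t)) ⟨hb0.le, hb1.le⟩ hb0.ne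
      (sub_pos.2 ((div_lt_one hb0).2 hab)) (div_pos ha0 hb0) (sub_add_cancel 1 (a / b))
    simp only [smul_eq_mul, mul_zero, zero_add, hzero, hb] at hconc
    rw [div_mul_cancel₀ a hb0.ne', ha, div_mul_div_comm,
      div_lt_div_iff₀ (by positivity) (by linarith)] at hconc
    nlinarith
  intro k n hk hkn
  refine ⟨?_, hstrict k n hk⟩
  rcases hkn.eq_or_lt with rfl | h
  · exact le_rfl
  · exact (hstrict k n hk h).le
end

section
/- Fix λ > 0 and define F(φ) = arccos((1 + λ·g(φ))/√(1 + λ²)), where g(φ) = (−(1 + cos φ) + √((1 + cos φ)² + 4λ² cos φ))/(2λ). Let n ≥ 3 be a natural number and let φ₁, …, φₙ be real numbers with 0 < φᵢ < π/2 for each i and φ₁ + ⋯ + φₙ ≥ π. Then F(φ₁) + ⋯ + F(φₙ) ≥ n·F(π/n). (This is the analytic core of the result that the regular spherical n-gon has minimal perimeter among all reduced spherical n-gons of the same thickness less than π/2.) -/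
open Real

/-- The positive root `u` of `u ^ 2 + (1 + cos x) * u = lam ^ 2 * cos x`. -/
noncomputable def quadRoot (lam x : ℝ) : ℝ :=
  (-(1 + cos x) + sqrt ((1 + cos x) ^ 2 + 4 * lam ^ 2 * cos x)) / 2

/-- Half of the contribution of an angle `x` to the perimeter. -/
noncomputable def halfPerimeter (lam x : ℝ) : ℝ :=
  arccos ((1 + quadRoot lam x) / sqrt (1 + lam ^ 2))

theorem cos_mem_Ioo_of_mem_Ioo {x : ℝ} (hx : x ∈ Set.Ioo 0 (π / 2)) :
    0 < cos x ∧ cos x < 1 := by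
  refine ⟨cos_pos_of_mem_Ioo ⟨by linarith [hx.1, pi_pos], hx.2⟩, ?_⟩
  have := cos_lt_cos_of_nonneg_of_le_pi_div_two le_rfl hx.2.le hx.1
  rwa [cos_zero] at this

theorem sqrt_discrim_eq (lam x : ℝ) :
    sqrt ((1 + cos x) ^ 2 + 4 * lam ^ 2 * cos x) = 2 * quadRoot lam x + 1 + cos x := by
  unfold quadRoot
  ring

theorem quadRoot_eq {lam x : ℝ} (hx : x ∈ Set.Ioo 0 (π / 2)) :
    quadRoot lam x ^ 2 + (1 + cos x) * quadRoot lam x = lam ^ 2 * cos x := by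
  have hc := (cos_mem_Ioo_of_mem_Ioo hx).1
  have h := sq_sqrt (show 0 ≤ (1 + cos x) ^ 2 + 4 * lam ^ 2 * cos x by positivity)
  rw [sqrt_discrim_eq] at h
  linarith

theorem quadRoot_pos {lam x : ℝ} (hlam : 0 < lam) (hx : x ∈ Set.Ioo 0 (π / 2)) :
    0 < quadRoot lam x := by
  have hc := (cos_mem_Ioo_of_mem_Ioo hx).1
  have h : 1 + cos x < sqrt ((1 + cos x) ^ 2 + 4 * lam ^ 2 * cos x) :=
    lt_sqrt_of_sq_lt (lt_add_of_pos_right _ (by positivity))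
  unfold quadRoot
  linarith

theorem quadRoot_sq_add_lt {lam x : ℝ} (hlam : 0 < lam) (hx : x ∈ Set.Ioo 0 (π / 2)) :
    quadRoot lam x ^ 2 + 2 * quadRoot lam x < lam ^ 2 := by
  obtain ⟨hc, hc1⟩ := cos_mem_Ioo_of_mem_Ioo hx
  have hu := quadRoot_pos hlam hx
  have he := quadRoot_eq (lam := lam) hx
  by_contra! h
  have h1 := mul_le_mul_of_nonneg_right h hc.le
  have h2 : 0 < (1 - cos x) * (quadRoot lam x ^ 2 + quadRoot lam x) :=
    mul_pos (by linarith) (by positivity)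
  nlinarith

theorem quadRoot_antitoneOn {lam : ℝ} (hlam : 0 < lam) :
    AntitoneOn (quadRoot lam) (Set.Ioo 0 (π / 2)) := by
  intro x hx y hy hxy
  have hc : cos y ≤ cos x :=
    cos_le_cos_of_nonneg_of_le_pi hx.1.le (by linarith [hy.2, pi_pos]) hxy
  have hcx := (cos_mem_Ioo_of_mem_Ioo hx).1
  have hux := quadRoot_pos hlam hx
  have huy := quadRoot_pos hlam hy
  have hex := quadRoot_eq (lam := lam) hx
  have hey := quadRoot_eq (lam := lam) hy
  have hly := quadRoot_sq_add_lt hlam hy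
  by_contra! h
  have h1 : 0 ≤ (cos x - cos y) * (lam ^ 2 - quadRoot lam y) :=
    mul_nonneg (by linarith) (by nlinarith)
  have h2 : 0 < (quadRoot lam y - quadRoot lam x) *
      (quadRoot lam y + quadRoot lam x + 1 + cos x) :=
    mul_pos (by linarith) (by linarith)
  nlinarith

theorem hasDerivAt_quadRoot {lam x : ℝ} (hlam : 0 < lam) (hx : x ∈ Set.Ioo 0 (π / 2)) :
    HasDerivAt (quadRoot lam)
      (-(sin x * (lam ^ 2 - quadRoot lam x) / (2 * quadRoot lam x + 1 + cos x))) x := by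
  have hc := (cos_mem_Ioo_of_mem_Ioo hx).1
  have hu := quadRoot_pos hlam hx
  have hcos := hasDerivAt_cos x
  have hQ := (((hcos.const_add 1).pow 2).add (hcos.const_mul (4 * lam ^ 2))).sqrt
    (by simp only [Pi.add_apply, Pi.pow_apply]; positivity)
  have h := ((hcos.const_add 1).neg.add hQ).div_const 2
  refine h.congr_deriv ?_
  simp only [Pi.add_apply, Pi.pow_apply]
  rw [sqrt_discrim_eq]
  have hW : 2 * quadRoot lam x + 1 + cos x ≠ 0 := by positivity
  field_simp
  ring

theorem hasDerivAt_halfPerimeter {lam x : ℝ} (hlam : 0 < lam) (hx : x ∈ Set.Ioo 0 (π / 2)) :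
    HasDerivAt (halfPerimeter lam)
      (sqrt (lam ^ 2 + quadRoot lam x ^ 2) / (2 * quadRoot lam x + 1 + cos x)) x := by
  have hc := (cos_mem_Ioo_of_mem_Ioo hx).1
  have hs : 0 < sin x := sin_pos_of_mem_Ioo ⟨hx.1, by linarith [hx.2, pi_pos]⟩
  have hu := quadRoot_pos hlam hx
  have he := quadRoot_eq (lam := lam) hx
  have hlt := quadRoot_sq_add_lt hlam hx
  have hd := hasDerivAt_quadRoot hlam hx
  have hsc := sin_sq_add_cos_sq x
  set u := quadRoot lam x with hu_def
  have hK : 0 < sqrt (1 + lam ^ 2) := sqrt_pos.2 (by positivity)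
  have hK2 : sqrt (1 + lam ^ 2) ^ 2 = 1 + lam ^ 2 := sq_sqrt (by positivity)
  have hs1 : (1 + u) / sqrt (1 + lam ^ 2) < 1 := by
    rw [div_lt_one hK]
    exact lt_sqrt_of_sq_lt (by linarith)
  have hs0 : 0 < (1 + u) / sqrt (1 + lam ^ 2) := by positivity
  have h := (hasDerivAt_arccos (by linarith) hs1.ne).comp x
    ((hd.const_add 1).div_const (sqrt (1 + lam ^ 2)))
  refine h.congr_deriv ?_
  have hA : 0 < lam ^ 2 - 2 * u - u ^ 2 := by linarith
  have h1 : sqrt (1 - ((1 + u) / sqrt (1 + lam ^ 2)) ^ 2) =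
      sqrt (lam ^ 2 - 2 * u - u ^ 2) / sqrt (1 + lam ^ 2) := by
    rw [← sqrt_div hA.le, div_pow, hK2]
    congr 1
    field_simp
    ring
  have h2 : sin x * (lam ^ 2 - u) =
      sqrt (lam ^ 2 + u ^ 2) * sqrt (lam ^ 2 - 2 * u - u ^ 2) := by
    rw [← sqrt_mul (by positivity), eq_comm, sqrt_eq_iff_mul_self_eq_of_pos
      (mul_pos hs (by nlinarith))]
    have h3 : cos x * (lam ^ 2 - u) = u * (1 + u) := by linarith
    have h4 : (cos x * (lam ^ 2 - u)) ^ 2 = (u * (1 + u)) ^ 2 := by rw [h3]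
    have h5 : sin x ^ 2 = 1 - cos x ^ 2 := by linarith
    calc sin x * (lam ^ 2 - u) * (sin x * (lam ^ 2 - u))
        = sin x ^ 2 * (lam ^ 2 - u) ^ 2 := by ring
      _ = (lam ^ 2 - u) ^ 2 - (cos x * (lam ^ 2 - u)) ^ 2 := by rw [h5]; ring
      _ = _ := by rw [h4]; ring
  have hA' := sqrt_pos.2 hA
  have hW : 2 * u + 1 + cos x ≠ 0 := by positivity
  rw [h1, h2]
  field_simp

theorem deriv_halfPerimeter_monotoneOn {lam : ℝ} (hlam : 0 < lam) :
    MonotoneOn (deriv (halfPerimeter lam)) (Set.Ioo 0 (π / 2)) := by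
  have key : ∀ x ∈ Set.Ioo 0 (π / 2), ∃ M, M = lam ^ 2 + 2 * lam ^ 2 * quadRoot lam x
      - quadRoot lam x ^ 2 ∧ 0 < M ∧ quadRoot lam x < lam ^ 2 ∧
      deriv (halfPerimeter lam) x = (lam ^ 2 - quadRoot lam x) *
        sqrt ((lam ^ 2 + quadRoot lam x ^ 2) / M * (1 / M)) := by
    intro x hx
    have hc := (cos_mem_Ioo_of_mem_Ioo hx).1
    have hu := quadRoot_pos hlam hx
    have he := quadRoot_eq (lam := lam) hx
    have hlt := quadRoot_sq_add_lt hlam hx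
    have hD : 0 < lam ^ 2 - quadRoot lam x := by nlinarith
    have hM : lam ^ 2 + 2 * lam ^ 2 * quadRoot lam x - quadRoot lam x ^ 2 =
        (2 * quadRoot lam x + 1 + cos x) * (lam ^ 2 - quadRoot lam x) := by linarith
    have hW : 0 < 2 * quadRoot lam x + 1 + cos x := by positivity
    refine ⟨_, rfl, by rw [hM]; positivity, by linarith, ?_⟩
    rw [(hasDerivAt_halfPerimeter hlam hx).deriv, hM, div_mul_div_comm, mul_one,
      sqrt_div (by positivity), sqrt_mul_self (by positivity)]
    field_simp
  intro x hx y hy hxy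
  obtain ⟨M, hM, hM0, hxL, hdx⟩ := key x hx
  obtain ⟨N, hN, hN0, hyL, hdy⟩ := key y hy
  have hvu := quadRoot_antitoneOn hlam hx hy hxy
  have hv := quadRoot_pos hlam hy
  have hlt := quadRoot_sq_add_lt hlam hx
  rw [hdx, hdy]
  set u := quadRoot lam x
  set v := quadRoot lam y
  have hNM : N ≤ M := by
    have : 0 ≤ (u - v) * (2 * lam ^ 2 - u - v) := mul_nonneg (by linarith) (by linarith)
    nlinarith
  have hR : (lam ^ 2 + u ^ 2) / M ≤ (lam ^ 2 + v ^ 2) / N := by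
    rw [div_le_div_iff₀ hM0 hN0]
    have h1 : 0 ≤ lam ^ 2 - (u + v) - u * v := by nlinarith
    have h2 : 0 ≤ 2 * lam ^ 2 * (u - v) * (lam ^ 2 - (u + v) - u * v) :=
      mul_nonneg (mul_nonneg (by positivity) (by linarith)) h1
    rw [hM, hN]
    linarith
  have hL : 0 ≤ lam ^ 2 - v := by linarith
  gcongr

theorem halfPerimeter_convexOn {lam : ℝ} (hlam : 0 < lam) :
    ConvexOn ℝ (Set.Ioo 0 (π / 2)) (halfPerimeter lam) := by
  refine MonotoneOn.convexOn_of_deriv (convex_Ioo _ _)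
    (fun x hx => (hasDerivAt_halfPerimeter hlam hx).continuousAt.continuousWithinAt) ?_ ?_
  · rw [interior_Ioo]
    exact fun x hx => (hasDerivAt_halfPerimeter hlam hx).differentiableAt.differentiableWithinAt
  · rw [interior_Ioo]
    exact deriv_halfPerimeter_monotoneOn hlam

theorem halfPerimeter_monotoneOn {lam : ℝ} (hlam : 0 < lam) :
    MonotoneOn (halfPerimeter lam) (Set.Ioo 0 (π / 2)) := by
  intro x hx y hy hxy
  have h := quadRoot_antitoneOn hlam hx hy hxy
  unfold halfPerimeter
  exact arccos_le_arccos (by gcongr)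

theorem stmt_10 (lam : ℝ) (hlam : 0 < lam)
    (n : ℕ) (hn : 3 ≤ n) (φ : Fin n → ℝ)
    (hφ : ∀ i, 0 < φ i ∧ φ i < π / 2)
    (hsum : π ≤ ∑ i, φ i) :
    let g := fun x : ℝ =>
      (-(1 + cos x) + sqrt ((1 + cos x) ^ 2 + 4 * lam ^ 2 * cos x)) / (2 * lam)
    let F := fun x : ℝ => arccos ((1 + lam * g x) / sqrt (1 + lam ^ 2))
    (n : ℝ) * F (π / n) ≤ ∑ i, F (φ i) := by
  intro g F
  have hF : F = halfPerimeter lam := by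
    funext x
    have hg : lam * g x = quadRoot lam x := by
      simp only [g, quadRoot]
      field_simp
    simp only [F, halfPerimeter, hg]
  rw [hF]
  have hn3 : (3 : ℝ) ≤ n := by exact_mod_cast hn
  have hn0 : (0 : ℝ) < n := by linarith
  have hw : ∑ _i : Fin n, (n : ℝ)⁻¹ = 1 := by
    simp [hn0.ne']
  have hmean : ∑ i, (n : ℝ)⁻¹ • φ i ∈ Set.Ioo 0 (π / 2) :=
    (convex_Ioo _ _).sum_mem (fun _ _ => by positivity) hw (fun i _ => hφ i)
  have hJ := (halfPerimeter_convexOn hlam).map_sum_le (t := Finset.univ)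
    (w := fun _ : Fin n => (n : ℝ)⁻¹) (p := φ) (fun _ _ => by positivity) hw (fun i _ => hφ i)
  have hle : π / n ≤ ∑ i, (n : ℝ)⁻¹ • φ i := by
    rw [← Finset.smul_sum, smul_eq_mul, div_eq_inv_mul]
    gcongr
  have hmono := halfPerimeter_monotoneOn hlam
    ⟨by positivity, hle.trans_lt hmean.2⟩ hmean hle
  have h := hmono.trans hJ
  rw [← Finset.smul_sum, smul_eq_mul, ← div_eq_inv_mul, le_div_iff₀' hn0] at h
  exact h
end

section
/- For every real number Δ with 0 < Δ < π/2, letting γ = arcsin((−cos Δ + √(cos² Δ + 8))/4), one has the identity arccos( cos Δ · √(1 − sin² Δ/(4 cos² γ)) ) = 2·arccos( 1/(2 sin γ) ). -/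
open Real

theorem stmt_11 (Δ : ℝ) (h1 : 0 < Δ) (h2 : Δ < π / 2) :
    let γ := arcsin ((-cos Δ + sqrt (cos Δ ^ 2 + 8)) / 4)
    arccos (cos Δ * sqrt (1 - sin Δ ^ 2 / (4 * cos γ ^ 2))) =
      2 * arccos (1 / (2 * sin γ)) := by
  intro γ
  have hc : 0 < cos Δ := cos_pos_of_mem_Ioo ⟨by linarith, h2⟩
  have hc1 : cos Δ ≤ 1 := cos_le_one Δ
  have hr : sqrt (cos Δ ^ 2 + 8) ^ 2 = cos Δ ^ 2 + 8 := sq_sqrt (by positivity)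
  have hlower : cos Δ + 2 ≤ sqrt (cos Δ ^ 2 + 8) := le_sqrt_of_sq_le (by nlinarith)
  have hupper : sqrt (cos Δ ^ 2 + 8) ≤ cos Δ + 4 :=
    (sqrt_le_left (by linarith)).2 (by nlinarith)
  have hs : sin γ = (-cos Δ + sqrt (cos Δ ^ 2 + 8)) / 4 :=
    sin_arcsin (by linarith) (by linarith)
  have hquad : cos Δ * sin γ = 1 - 2 * sin γ ^ 2 := by
    rw [hs]; linear_combination hr / 8
  have hhalf : 1 / 2 ≤ sin γ := by rw [hs]; linarith
  have hpos : 0 < sin γ := by linarith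
  have hcosγ : cos γ ^ 2 = 1 - sin γ ^ 2 := cos_sq' γ
  have hne : 1 - sin γ ^ 2 ≠ 0 := by nlinarith [mul_pos hc hpos]
  have hsqrt : sqrt (1 - sin Δ ^ 2 / (4 * cos γ ^ 2)) = 1 / (2 * sin γ) := by
    rw [← sqrt_sq (show 0 ≤ 1 / (2 * sin γ) by positivity)]
    congr 1
    rw [hcosγ, sin_sq Δ]
    field_simp
    linear_combination 4 * (cos Δ * sin γ + 1 - 2 * sin γ ^ 2) * hquad
  have hle : 1 / (2 * sin γ) ≤ 1 := by
    rw [div_le_one (by positivity)]; linarith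
  have hnonneg : 0 ≤ 1 / (2 * sin γ) := by positivity
  have hcos : cos (2 * arccos (1 / (2 * sin γ))) = cos Δ * (1 / (2 * sin γ)) := by
    rw [cos_two_mul, cos_arccos (by linarith) hle]
    field_simp
    linear_combination -hquad
  rw [hsqrt, ← hcos]
  exact arccos_cos (by linarith [arccos_nonneg (1 / (2 * sin γ))])
    (by linarith [arccos_le_pi_div_two.2 hnonneg])
end

section
/- Let Δ ∈ (0, π/2) and set γ = arcsin((−cos Δ + √(cos² Δ + 8))/4). Suppose β, γ′, a, c are real numbers with 0 < β ≤ γ, 2β ≤ γ′ ≤ π/2, 0 < a < π/2, 0 < c < π, sin a · sin γ′ = sin Δ · sin β, and cos c = cos Δ · cos a. Then c ≤ 2·arccos(1/(2 sin γ)). -/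
open Real

theorem stmt_12 (Δ : ℝ) (hΔ1 : 0 < Δ) (hΔ2 : Δ < π / 2)
    (γ β γ' a c : ℝ)
    (hγ : γ = arcsin ((-cos Δ + sqrt (cos Δ ^ 2 + 8)) / 4))
    (hβ1 : 0 < β) (hβ2 : β ≤ γ)
    (hγ'1 : 2 * β ≤ γ') (hγ'2 : γ' ≤ π / 2)
    (ha1 : 0 < a) (ha2 : a < π / 2)
    (hc1 : 0 < c) (hc2 : c < π)
    (hsine : sin a * sin γ' = sin Δ * sin β)
    (hpyth : cos c = cos Δ * cos a) :
    c ≤ 2 * arccos (1 / (2 * sin γ)) := by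
  have hk0 : 0 < cos Δ := cos_pos_of_mem_Ioo ⟨by linarith, hΔ2⟩
  have hk1 : cos Δ < 1 := by
    simpa using cos_lt_cos_of_nonneg_of_le_pi_div_two le_rfl hΔ2.le hΔ1
  have hr : sqrt (cos Δ ^ 2 + 8) ^ 2 = cos Δ ^ 2 + 8 := sq_sqrt (by positivity)
  have hr0 : 0 ≤ sqrt (cos Δ ^ 2 + 8) := sqrt_nonneg _
  have hrlow : cos Δ + 2 < sqrt (cos Δ ^ 2 + 8) := by nlinarith
  have hrupp : sqrt (cos Δ ^ 2 + 8) < 3 + cos Δ := by nlinarith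
  have hsin : sin γ = (-cos Δ + sqrt (cos Δ ^ 2 + 8)) / 4 := by
    rw [hγ]
    exact sin_arcsin (by linarith) (by linarith)
  have hs : 1 / 2 < sin γ := by linarith
  have hs1 : sin γ < 1 := by linarith
  have hquad : 2 * sin γ ^ 2 + cos Δ * sin γ = 1 := by
    rw [hsin]
    linear_combination hr / 8
  have hγle : γ ≤ π / 2 := hγ ▸ arcsin_le_pi_div_two _
  have hcosγ : 0 ≤ cos γ := cos_nonneg_of_mem_Icc ⟨by linarith, hγle⟩
  have hcosβ : cos γ ≤ cos β := cos_le_cos_of_nonneg_of_le_pi hβ1.le (by linarith) hβ2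
  have hsina : 0 < sin a := sin_pos_of_pos_of_lt_pi ha1 (by linarith)
  have hcosa : 0 < cos a := cos_pos_of_mem_Ioo ⟨by linarith, ha2⟩
  have hsinβ : 0 < sin β := sin_pos_of_pos_of_lt_pi hβ1 (by linarith)
  have hsinΔ : 2 * sin a * cos γ ≤ sin Δ := by
    have h2β : sin (2 * β) ≤ sin γ' := sin_le_sin_of_le_of_le_pi_div_two (by linarith) hγ'2 hγ'1
    rw [sin_two_mul] at h2β
    have h : 2 * sin a * cos β ≤ sin Δ := by
      refine le_of_mul_le_mul_right ?_ hsinβ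
      nlinarith [mul_le_mul_of_nonneg_left h2β hsina.le]
    nlinarith [mul_le_mul_of_nonneg_left hcosβ hsina.le]
  have hsq : 4 * sin a ^ 2 * (1 - sin γ ^ 2) ≤ 1 - cos Δ ^ 2 := by
    have h := pow_le_pow_left₀ (by positivity) hsinΔ 2
    rw [← cos_sq', ← sin_sq]
    linarith
  have hfactor : sin γ ^ 2 * (1 - cos Δ ^ 2) = (4 * sin γ ^ 2 - 1) * (1 - sin γ ^ 2) := by
    have hks : cos Δ * sin γ = 1 - 2 * sin γ ^ 2 := by linarith
    linear_combination -(cos Δ * sin γ + 1 - 2 * sin γ ^ 2) * hks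
  have hsina_le : 4 * sin γ ^ 2 * sin a ^ 2 ≤ 4 * sin γ ^ 2 - 1 := by
    refine le_of_mul_le_mul_right ?_ (show 0 < 1 - sin γ ^ 2 by nlinarith)
    nlinarith [mul_le_mul_of_nonneg_left hsq (sq_nonneg (sin γ))]
  have hcosa_ge : 1 / (2 * sin γ) ≤ cos a := by
    rw [div_le_iff₀ (by linarith)]
    refine (pow_le_pow_iff_left₀ (by norm_num) (by positivity) two_ne_zero).1 ?_
    nlinarith [sin_sq_add_cos_sq a]
  have hcosγc : cos (2 * arccos (1 / (2 * sin γ))) = cos Δ * (1 / (2 * sin γ)) := by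
    have hpos : 0 ≤ 1 / (2 * sin γ) := by positivity
    have hle : 1 / (2 * sin γ) ≤ 1 := hcosa_ge.trans (cos_le_one a)
    rw [cos_two_mul, cos_arccos (by linarith) hle]
    field_simp
    linarith
  by_contra! hlt
  have h := cos_lt_cos_of_nonneg_of_le_pi
    (mul_nonneg zero_le_two (arccos_nonneg _)) hc2.le hlt
  rw [hcosγc, hpyth] at h
  exact h.not_ge (mul_le_mul_of_nonneg_left hcosa_ge hk0.le)
end

section
/- For every real number Δ with 0 < Δ < π/2, letting γ = arcsin((−cos Δ + √(cos² Δ + 8))/4), one has the strict inequality 2·arccos(1/(2 sin γ)) < arccos( cos Δ · √(1 − (√2/2)·sin Δ) ). -/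
open Real

theorem stmt_13 (Δ : ℝ) (h1 : 0 < Δ) (h2 : Δ < π / 2) :
    let γ := arcsin ((-cos Δ + sqrt (cos Δ ^ 2 + 8)) / 4)
    2 * arccos (1 / (2 * sin γ)) <
      arccos (cos Δ * sqrt (1 - (sqrt 2 / 2) * sin Δ)) := by
  intro γ
  have hc : 0 < cos Δ := cos_pos_of_mem_Ioo ⟨by linarith, h2⟩
  have hw : 0 < sin Δ := sin_pos_of_pos_of_lt_pi h1 (by linarith [pi_pos])
  have hcw := sin_sq_add_cos_sq Δ
  have hr0 : 0 ≤ sqrt (cos Δ ^ 2 + 8) := sqrt_nonneg _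
  have hr2 : sqrt (cos Δ ^ 2 + 8) ^ 2 = cos Δ ^ 2 + 8 := sq_sqrt (by positivity)
  have hγ : sin γ = (-cos Δ + sqrt (cos Δ ^ 2 + 8)) / 4 :=
    sin_arcsin (by nlinarith) (by nlinarith)
  rw [hγ]
  generalize sqrt (cos Δ ^ 2 + 8) = r at hr0 hr2
  generalize cos Δ = c at hc hcw hr2
  generalize sin Δ = w at hw hcw
  have hc1 : c < 1 := by nlinarith
  have hw1 : w < 1 := by nlinarith
  have hrc : c < r := by nlinarith
  have hr3 : r < 3 := by nlinarith
  have ht : 1 / (2 * ((-c + r) / 4)) = (c + r) / 4 := by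
    have : -c + r ≠ 0 := by linarith
    field_simp
    linarith
  rw [ht]
  -- the tangent line of `√(x² + 8)` at `x = 1`
  have htangent : (8 + c) / 3 ≤ r := by nlinarith [sq_nonneg (c - 1)]
  have hsqrt : sqrt (1 - sqrt 2 / 2 * w) < (c + r) / 4 := by
    rw [sqrt_lt' (by linarith)]
    have h2w : 1 * w < sqrt 2 * w := by
      gcongr
      exact lt_sqrt_of_sq_lt (by norm_num)
    nlinarith [mul_le_mul_of_nonneg_left htangent hc.le, mul_pos hw (sub_pos.2 hw1),
      mul_pos hc (sub_pos.2 hc1)]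
  have hcos : cos (2 * arccos ((c + r) / 4)) = c * ((c + r) / 4) := by
    rw [cos_two_mul, cos_arccos (by linarith) (by linarith)]
    linarith
  have harccos : arccos ((c + r) / 4) ≤ π / 2 := arccos_le_pi_div_two.2 (by linarith)
  rw [← arccos_cos (x := 2 * arccos ((c + r) / 4))
    (by linarith [arccos_nonneg ((c + r) / 4)]) (by linarith), hcos]
  refine arccos_lt_arccos ?_ (mul_lt_mul_of_pos_left hsqrt hc) (by nlinarith)
  have := mul_nonneg hc.le (sqrt_nonneg (1 - sqrt 2 / 2 * w))
  linarith
end
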